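/- Let Φ : V^{⊗n} → W̃_{z₁,…,zₙ} be composable with m vertex operators, and let p, q ∈ ℤ₊ with p + q ≤ m and l₁,…,lₙ ∈ ℤ₊ with l₁+⋯+lₙ = p+n. Then E^{(q)}_W ∘_{q+1} (Φ∘(E^{(l₁)}_{V;1}⊗⋯⊗E^{(lₙ)}_{V;1})) = (E^{(q)}_W ∘_{q+1} Φ)∘(E^{(l₁)}_{V;1}⊗⋯⊗E^{(lₙ)}_{V;1}). -/

import Mathlib

open scoped BigOperators Classical

noncomputable section VertexCohomology

/-! ## Rational functions with prescribed poles -/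

/-- A function of `n` complex variables (restricted to the configuration space of
pairwise distinct points) which is a rational function with the only possible poles
on the diagonals `z i = z j`, `i ≠ j`. -/
def RatDiag (n : ℕ) (f : (Fin n → ℂ) → ℂ) : Prop :=
  ∃ (P : MvPolynomial (Fin n) ℂ) (N : ℕ),
    ∀ z : Fin n → ℂ, (∀ i j : Fin n, i ≠ j → z i ≠ z j) →
      f z * ∏ i : Fin n, ∏ j : Fin n, (if i < j then (z i - z j) ^ N else 1)
        = MvPolynomial.eval z P

/-- A rational function of `n` variables with the only possible poles at
`z i = z j` (`i ≠ j`) and `z i = 0`. -/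
def RatFull (n : ℕ) (f : (Fin n → ℂ) → ℂ) : Prop :=
  ∃ (P : MvPolynomial (Fin n) ℂ) (N : ℕ),
    ∀ z : Fin n → ℂ, (∀ i, z i ≠ 0) → (∀ i j : Fin n, i ≠ j → z i ≠ z j) →
      f z * ((∏ i : Fin n, z i ^ N) *
        ∏ i : Fin n, ∏ j : Fin n, (if i < j then (z i - z j) ^ N else 1))
        = MvPolynomial.eval z P

/-- A rational function of `n` variables with the only possible poles at
`z i = z j` (`i ≠ j`), the pole at `z i = z j` being of order at most `Nb i j`. -/
def RatDiagBnd (n : ℕ) (Nb : Fin n → Fin n → ℕ) (f : (Fin n → ℂ) → ℂ) : Prop :=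
  ∃ P : MvPolynomial (Fin n) ℂ,
    ∀ z : Fin n → ℂ, (∀ i j : Fin n, i ≠ j → z i ≠ z j) →
      f z * ∏ i : Fin n, ∏ j : Fin n, (if i < j then (z i - z j) ^ (Nb i j) else 1)
        = MvPolynomial.eval z P

/-- A rational function of one variable with the only possible pole at `0`. -/
def RatOne (f : ℂ → ℂ) : Prop :=
  ∃ (P : Polynomial ℂ) (N : ℕ), ∀ z : ℂ, z ≠ 0 → f z * z ^ N = Polynomial.eval z P

/-! ## Graded duals -/

/-- A linear functional on a `ℤ`-graded space belonging to the graded (restricted) dual: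
it is nonzero on only finitely many homogeneous subspaces. -/
def GradedFunctionalZ {V : Type} [AddCommGroup V] [Module ℂ V]
    (grading : ℤ → Submodule ℂ V) (f : V →ₗ[ℂ] ℂ) : Prop :=
  {k : ℤ | ∃ v ∈ grading k, f v ≠ 0}.Finite

/-- A linear functional on a `ℂ`-graded space belonging to the graded (restricted) dual. -/
def GradedFunctionalC {W : Type} [AddCommGroup W] [Module ℂ W]
    (grading : ℂ → Submodule ℂ W) (f : W →ₗ[ℂ] ℂ) : Prop :=
  {c : ℂ | ∃ w ∈ grading c, f w ≠ 0}.Finite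

/-! ## Grading-restricted vertex algebras and modules -/

variable (V : Type) [AddCommGroup V] [Module ℂ V]
variable (W : Type) [AddCommGroup W] [Module ℂ W]

/-- A grading-restricted vertex algebra structure on `V`, with the duality property
(for products and iterates of two vertex operators) as the main axiom.
`Y u v k` denotes the coefficient `(Y_V)_k(u)v` of `x^{-k-1}` in `Y_V(u,x)v`. -/
structure GRVA where
  grading : ℤ → Submodule ℂ V
  decomp : DirectSum.Decomposition grading
  finiteDim : ∀ k : ℤ, Module.Finite ℂ (grading k)
  lower_bounded : ∃ N : ℤ, ∀ k : ℤ, k < N → grading k = ⊥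
  Y : V →ₗ[ℂ] V →ₗ[ℂ] (ℤ → V)
  vacuum : V
  vacuum_mem : vacuum ∈ grading 0
  trunc : ∀ u v : V, ∃ N : ℤ, ∀ k : ℤ, N ≤ k → Y u v k = 0
  identity : ∀ (v : V) (k : ℤ), Y vacuum v k = if k = -1 then v else 0
  creation : ∀ (u : V) (k : ℤ), 0 ≤ k → Y u vacuum k = 0
  creation_lim : ∀ u : V, Y u vacuum (-1) = u
  L0 : Module.End ℂ V
  L0_eq : ∀ (k : ℤ) (v : V), v ∈ grading k → L0 v = (k : ℂ) • v
  Lm1 : Module.End ℂ V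
  Lm1_eq : ∀ v : V, Lm1 v = Y v vacuum (-2)
  L0_bracket : ∀ (u v : V) (k : ℤ), L0 (Y u v k)
      = Y (L0 u) v k + Y u (L0 v) k + ((-k - 1 : ℤ) : ℂ) • Y u v k
  Lm1_deriv : ∀ (u v : V) (k : ℤ), Y (Lm1 u) v k = (-k : ℂ) • Y u v (k - 1)
  Lm1_bracket : ∀ (u v : V) (k : ℤ),
      Lm1 (Y u v k) - Y u (Lm1 v) k = (-k : ℂ) • Y u v (k - 1)
  duality : ∀ (u₁ u₂ v : V) (v' : V →ₗ[ℂ] ℂ), GradedFunctionalZ grading v' →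
    ∃ f : (Fin 2 → ℂ) → ℂ, RatFull 2 f ∧
      (∀ z₁ z₂ : ℂ, ‖z₁‖ > ‖z₂‖ → z₂ ≠ 0 →
        HasSum (fun k : ℤ × ℤ =>
          v' (Y u₁ (Y u₂ v k.2) k.1) * z₁ ^ (-k.1 - 1) * z₂ ^ (-k.2 - 1)) (f ![z₁, z₂])) ∧
      (∀ z₁ z₂ : ℂ, ‖z₂‖ > ‖z₁‖ → z₁ ≠ 0 →
        HasSum (fun k : ℤ × ℤ =>
          v' (Y u₂ (Y u₁ v k.1) k.2) * z₁ ^ (-k.1 - 1) * z₂ ^ (-k.2 - 1)) (f ![z₁, z₂])) ∧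
      (∀ z₁ z₂ : ℂ, ‖z₂‖ > ‖z₁ - z₂‖ → z₁ ≠ z₂ → z₂ ≠ 0 →
        HasSum (fun k : ℤ × ℤ =>
          v' (Y (Y u₁ u₂ k.1) v k.2) * (z₁ - z₂) ^ (-k.1 - 1) * z₂ ^ (-k.2 - 1))
          (f ![z₁, z₂]))

/-- A grading-restricted generalized module structure on `W` for a
grading-restricted vertex algebra structure `A` on `V`. -/
structure GRMod (A : GRVA V) where
  grading : ℂ → Submodule ℂ W
  decomp : DirectSum.Decomposition grading
  lower_trunc : ∃ N : ℝ, ∀ c : ℂ, c.re < N → grading c = ⊥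
  Y : V →ₗ[ℂ] W →ₗ[ℂ] (ℤ → W)
  trunc : ∀ (u : V) (w : W), ∃ N : ℤ, ∀ k : ℤ, N ≤ k → Y u w k = 0
  identity : ∀ (w : W) (k : ℤ), Y A.vacuum w k = if k = -1 then w else 0
  L0 : Module.End ℂ W
  Lm1 : Module.End ℂ W
  L0_mem : ∀ (c : ℂ) (w : W), w ∈ grading c → L0 w ∈ grading c
  Lm1_mem : ∀ (c : ℂ) (w : W), w ∈ grading c → Lm1 w ∈ grading (c + 1)
  L0_bracket : ∀ (u : V) (w : W) (k : ℤ), L0 (Y u w k)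
      = Y (A.L0 u) w k + Y u (L0 w) k + ((-k - 1 : ℤ) : ℂ) • Y u w k
  L0_nilpotent : ∀ (c : ℂ) (w : W), w ∈ grading c →
      ∃ K : ℕ, ((L0 - c • 1) ^ K) w = 0
  Lm1_deriv : ∀ (u : V) (w : W) (k : ℤ), Y (A.Lm1 u) w k = (-k : ℂ) • Y u w (k - 1)
  Lm1_bracket : ∀ (u : V) (w : W) (k : ℤ),
      Lm1 (Y u w k) - Y u (Lm1 w) k = (-k : ℂ) • Y u w (k - 1)
  duality : ∀ (u₁ u₂ : V) (w : W) (w' : W →ₗ[ℂ] ℂ), GradedFunctionalC grading w' →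
    ∃ f : (Fin 2 → ℂ) → ℂ, RatFull 2 f ∧
      (∀ z₁ z₂ : ℂ, ‖z₁‖ > ‖z₂‖ → z₂ ≠ 0 →
        HasSum (fun k : ℤ × ℤ =>
          w' (Y u₁ (Y u₂ w k.2) k.1) * z₁ ^ (-k.1 - 1) * z₂ ^ (-k.2 - 1)) (f ![z₁, z₂])) ∧
      (∀ z₁ z₂ : ℂ, ‖z₂‖ > ‖z₁‖ → z₁ ≠ 0 →
        HasSum (fun k : ℤ × ℤ =>
          w' (Y u₂ (Y u₁ w k.1) k.2) * z₁ ^ (-k.1 - 1) * z₂ ^ (-k.2 - 1)) (f ![z₁, z₂])) ∧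
      (∀ z₁ z₂ : ℂ, ‖z₂‖ > ‖z₁ - z₂‖ → z₁ ≠ z₂ → z₂ ≠ 0 →
        HasSum (fun k : ℤ × ℤ =>
          w' (Y (A.Y u₁ u₂ k.1) w k.2) * (z₁ - z₂) ^ (-k.1 - 1) * z₂ ^ (-k.2 - 1))
          (f ![z₁, z₂]))

variable {V W}

/-! ## Algebraic completions -/

/-- The algebraic completion `W̄ = ∏_{c ∈ ℂ} W_(c)` of a `ℂ`-graded module. -/
abbrev WbarT {A : GRVA V} (M : GRMod V W A) : Type := ∀ c : ℂ, M.grading c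

/-- The algebraic completion `V̄ = ∏_{k ∈ ℤ} V_(k)`. -/
abbrev VbarT (A : GRVA V) : Type := ∀ k : ℤ, A.grading k

/-- The pairing `⟨w', ω⟩` of an element `w'` of the graded dual `W'` with an
element `ω` of the algebraic completion `W̄`. -/
def pairBar {A : GRVA V} {M : GRMod V W A} (w' : W →ₗ[ℂ] ℂ) (ω : WbarT M) : ℂ :=
  ∑ᶠ c : ℂ, w' (ω c : W)

/-- The pairing of an element of the graded dual `V'` with an element of `V̄`. -/
def pairBarV {A : GRVA V} (v' : V →ₗ[ℂ] ℂ) (ω : VbarT A) : ℂ :=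
  ∑ᶠ k : ℤ, v' (ω k : V)

/-- The homogeneous component `P_r ω ∈ V` of `ω ∈ V̄` for `r ∈ ℂ`
(zero when `r` is not an integer). -/
def VbarComp {A : GRVA V} (ω : VbarT A) (r : ℂ) : V :=
  if h : ∃ k : ℤ, (k : ℂ) = r then (ω h.choose : V) else 0

/-! ## Iterated vertex operators -/

/-- `applyList Yop v k L w` applies the coefficients `(Yop (v t)) · (k t)` of the
vertex operators at the positions listed in `L` (head outermost) to `w`. -/
def applyList {X : Type} [AddCommGroup X] [Module ℂ X] {n : ℕ}
    (Yop : V →ₗ[ℂ] X →ₗ[ℂ] (ℤ → X)) (v : Fin n → V) (k : Fin n → ℤ) :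
    List (Fin n) → X → X
  | [], w => w
  | t :: ts, w => Yop (v t) (applyList Yop v k ts w) (k t)

/-- The coefficient of `z^{-p-1}` in `Y^W_{WV}(w, z)v = e^{zL_W(-1)} Y_W(v, -z)w`. -/
def YWVcoef {A : GRVA V} (M : GRMod V W A) (w : W) (v : V) (p : ℤ) : W :=
  ∑ᶠ m : ℕ, (((m.factorial : ℂ))⁻¹ * (-1 : ℂ) ^ ((m : ℤ) - p)) •
    ((M.Lm1 ^ m) (M.Y v w ((m : ℤ) - p - 1)))

/-! ## The `E`-families: products of vertex operators with values in completions -/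

/-- `IsEVFam A EV` says that `EV l v z ∈ V̄` realizes
`(E^{(l)}_V(v₁ ⊗ ⋯ ⊗ v_l; 𝟏))(z₁, …, z_l) = E(Y_V(v₁,z₁) ⋯ Y_V(v_l,z_l)𝟏)`:
its pairing with every graded functional `v'` is the rational extension (with only
possible poles on the diagonals) of the series of products of `l` vertex operators
acting on the vacuum, which converges in the region `|z₁| > ⋯ > |z_l| > 0`. -/
def IsEVFam (A : GRVA V) (EV : ∀ l : ℕ, (Fin l → V) → (Fin l → ℂ) → VbarT A) : Prop :=
  ∀ (l : ℕ) (v : Fin l → V) (v' : V →ₗ[ℂ] ℂ), GradedFunctionalZ A.grading v' →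
    ∃ f : (Fin l → ℂ) → ℂ, RatDiag l f ∧
      (∀ z : Fin l → ℂ, (List.finRange l).Chain' (fun s t => ‖z s‖ > ‖z t‖) →
          (∀ t, z t ≠ 0) →
        HasSum (fun k : Fin l → ℤ =>
          v' (applyList A.Y v k (List.finRange l) A.vacuum) *
            ∏ t, z t ^ (-(k t) - 1)) (f z)) ∧
      (∀ z, (∀ s t, s ≠ t → z s ≠ z t) → pairBarV v' (EV l v z) = f z)

/-- `IsEWFam A M EW` says that `EW m v u z ∈ W̄` realizes
`(E^{(m)}_W(v₁ ⊗ ⋯ ⊗ v_m; u))(z₁, …, z_m) = E(Y_W(v₁,z₁) ⋯ Y_W(v_m,z_m)u)`: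
its pairing with every graded functional `w'` is the rational extension (with only
possible poles at `z i = z j` and `z i = 0`) of the series of products of `m` module
vertex operators acting on `u`, convergent for `|z₁| > ⋯ > |z_m| > 0`. -/
def IsEWFam {A : GRVA V} (M : GRMod V W A)
    (EW : ∀ m : ℕ, (Fin m → V) → W → (Fin m → ℂ) → WbarT M) : Prop :=
  ∀ (m : ℕ) (v : Fin m → V) (u : W) (w' : W →ₗ[ℂ] ℂ), GradedFunctionalC M.grading w' →
    ∃ f : (Fin m → ℂ) → ℂ, RatFull m f ∧
      (∀ z : Fin m → ℂ, (List.finRange m).Chain' (fun s t => ‖z s‖ > ‖z t‖) →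
          (∀ t, z t ≠ 0) →
        HasSum (fun k : Fin m → ℤ =>
          w' (applyList M.Y v k (List.finRange m) u) *
            ∏ t, z t ^ (-(k t) - 1)) (f z)) ∧
      (∀ z, (∀ s t, s ≠ t → z s ≠ z t) → (∀ t, z t ≠ 0) →
        pairBar w' (EW m v u z) = f z)

/-- `IsEWV1Fam A M G` says that `G m u v ζz ∈ W̄` realizes
`(E^{W;(1,m)}_{WV}(u; v₁ ⊗ ⋯ ⊗ v_m))(ζ, z₁, …, z_m)
  = E(Y^W_{WV}(u,ζ) Y_V(v₁,z₁) ⋯ Y_V(v_m,z_m)𝟏)`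
(first variable is the `ζ`-slot of `Y^W_{WV}`): its pairing with every graded
functional is the rational extension (poles only on diagonals) of the corresponding
series, convergent for `|ζ| > |z₁| > ⋯ > |z_m| > 0`. -/
def IsEWV1Fam {A : GRVA V} (M : GRMod V W A)
    (G : ∀ m : ℕ, W → (Fin m → V) → (Fin (m + 1) → ℂ) → WbarT M) : Prop :=
  ∀ (m : ℕ) (u : W) (v : Fin m → V) (w' : W →ₗ[ℂ] ℂ), GradedFunctionalC M.grading w' →
    ∃ f : (Fin (m + 1) → ℂ) → ℂ, RatDiag (m + 1) f ∧
      (∀ z : Fin (m + 1) → ℂ,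
          (List.finRange (m + 1)).Chain' (fun s t => ‖z s‖ > ‖z t‖) →
          (∀ t, z t ≠ 0) →
        HasSum (fun k : Fin (m + 1) → ℤ =>
          w' (YWVcoef M u
              (applyList A.Y v (fun t => k t.succ) (List.finRange m) A.vacuum) (k 0)) *
            ∏ t, z t ^ (-(k t) - 1)) (f z)) ∧
      (∀ z, (∀ s t, s ≠ t → z s ≠ z t) → pairBar w' (G m u v z) = f z)

/-- `IsEn1Fam A M E` says that `E m v u zζ ∈ W̄` realizes
`(E^{(m,1)}_W(v₁ ⊗ ⋯ ⊗ v_m; u))(z₁, …, z_m, ζ)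
  = E(Y_W(v₁,z₁) ⋯ Y_W(v_m,z_m) Y^W_{WV}(u,ζ)𝟏)`
(the last variable is the `ζ`-slot): its pairing with every graded functional is
the rational extension (poles only on diagonals) of the corresponding series,
convergent for `|z₁| > ⋯ > |z_m| > |ζ| > 0`. -/
def IsEn1Fam {A : GRVA V} (M : GRMod V W A)
    (E : ∀ m : ℕ, (Fin m → V) → W → (Fin (m + 1) → ℂ) → WbarT M) : Prop :=
  ∀ (m : ℕ) (v : Fin m → V) (u : W) (w' : W →ₗ[ℂ] ℂ), GradedFunctionalC M.grading w' →
    ∃ f : (Fin (m + 1) → ℂ) → ℂ, RatDiag (m + 1) f ∧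
      (∀ z : Fin (m + 1) → ℂ,
          (List.finRange (m + 1)).Chain' (fun s t => ‖z s‖ > ‖z t‖) →
          (∀ t, z t ≠ 0) →
        HasSum (fun k : Fin (m + 1) → ℤ =>
          w' (applyList M.Y v (fun t => k t.castSucc) (List.finRange m)
              (YWVcoef M u A.vacuum (k (Fin.last m)))) *
            ∏ t, z t ^ (-(k t) - 1)) (f z)) ∧
      (∀ z, (∀ s t, s ≠ t → z s ≠ z t) → pairBar w' (E m v u z) = f z)

/-! ## Cochains -/

/-- The space of `n`-cochains: linear maps from `V^{⊗n}` to the space of functions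
from `n`-tuples of complex numbers to `W̄` (only the restriction to the configuration
space `F_nℂ` is relevant; `W̄`-valued rationality is imposed separately). -/
abbrev Cochain {A : GRVA V} (M : GRMod V W A) (n : ℕ) :=
  MultilinearMap ℂ (fun _ : Fin n => V) ((Fin n → ℂ) → WbarT M)

/-- `Φ` takes values in `W̄`-valued rational functions with the only possible poles
at `z i = z j`, `i ≠ j` (i.e. in `W̃_{z₁,…,zₙ}`). -/
def TakesRatValues {A : GRVA V} {M : GRMod V W A} {n : ℕ} (Φ : Cochain M n) : Prop :=
  ∀ (v : Fin n → V) (w' : W →ₗ[ℂ] ℂ), GradedFunctionalC M.grading w' →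
    RatDiag n (fun z => pairBar w' (Φ v z))

/-- Pre-composition of the complex variables with an equivalence, as a linear map. -/
def precompZ {X : Type} [AddCommGroup X] [Module ℂ X] {a b : ℕ} (e : Fin a ≃ Fin b) :
    ((Fin a → ℂ) → X) →ₗ[ℂ] ((Fin b → ℂ) → X) where
  toFun f := fun zb => f (fun i => zb (e i))
  map_add' _ _ := rfl
  map_smul' _ _ := rfl

/-- Transport of a cochain along an identification of index sets; for `e = σ ∈ Sₙ`
this is the action `(σ(Φ))(v₁ ⊗ ⋯ ⊗ vₙ) = σ(Φ(v_{σ(1)} ⊗ ⋯ ⊗ v_{σ(n)}))`,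
i.e. `(transport σ Φ) v z = Φ (v ∘ σ) (z ∘ σ)`. -/
def transport {A : GRVA V} {M : GRMod V W A} {a b : ℕ} (e : Fin a ≃ Fin b)
    (Φ : Cochain M a) : Cochain M b :=
  (precompZ e).compMultilinearMap (MultilinearMap.domDomCongr e Φ)
/-! ## Operators on the algebraic completion -/

lemma Lm1_pow_mem {A : GRVA V} (M : GRMod V W A) (m : ℕ) (c : ℂ) (w : W)
    (h : w ∈ M.grading c) : (M.Lm1 ^ m) w ∈ M.grading (c + m) := by
  induction m generalizing c w with
  | zero => simpa using h
  | succ K ih =>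
    have h1 : (M.Lm1 ^ (K + 1)) w = (M.Lm1 ^ K) (M.Lm1 w) := by
      rw [pow_succ]; rfl
    have h2 := ih (c + 1) (M.Lm1 w) (M.Lm1_mem c w h)
    have h3 : c + 1 + (K : ℂ) = c + ((K : ℕ) + 1 : ℕ) := by push_cast; ring
    rw [h1]
    rw [h3] at h2
    exact h2

/-- The extension of `L_W(-1)` to the algebraic completion `W̄`. -/
def Lm1bar {A : GRVA V} (M : GRMod V W A) (ω : WbarT M) : WbarT M := fun c =>
  ⟨M.Lm1 (ω (c - 1) : W), by
    have h := M.Lm1_mem (c - 1) _ (ω (c - 1)).2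
    have h2 : c - 1 + 1 = c := by ring
    rwa [h2] at h⟩

/-- The operator `e^{ζ L_W(-1)}` on the algebraic completion `W̄`, well defined
componentwise thanks to the shift of weights and lower truncation. -/
def expLm1 {A : GRVA V} (M : GRMod V W A) (ζ : ℂ) (ω : WbarT M) : WbarT M := fun c =>
  ∑ᶠ m : ℕ, ((ζ ^ m * ((m.factorial : ℂ))⁻¹) •
    (⟨(M.Lm1 ^ m) (ω (c - m) : W), by
        have h := Lm1_pow_mem M m (c - m) _ (ω (c - m)).2
        have h2 : c - (m : ℂ) + m = c := by ring
        rwa [h2] at h⟩ : M.grading c))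

lemma L0nil_mem {A : GRVA V} (M : GRMod V W A) (K : ℕ) (c : ℂ) (w : W)
    (h : w ∈ M.grading c) : ((M.L0 - c • 1) ^ K) w ∈ M.grading c := by
  induction K generalizing w with
  | zero => simpa using h
  | succ K ih =>
    have h1 : ((M.L0 - c • 1) ^ (K + 1)) w = ((M.L0 - c • 1) ^ K) ((M.L0 - c • 1) w) := by
      rw [pow_succ]; rfl
    rw [h1]
    apply ih
    have h2 : (M.L0 - c • 1) w = M.L0 w - c • w := by
      simp [LinearMap.sub_apply]
    rw [h2]
    exact Submodule.sub_mem _ (M.L0_mem c w h) (Submodule.smul_mem _ c h)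

/-- The operator `z^{L_W(0)} = e^{(log z)(L_W(0))_s} e^{(log z)(L_W(0)-(L_W(0))_s)}`
on the algebraic completion `W̄`, defined using the semisimple part (which acts on
`W_(c)` as multiplication by `c`) and the locally nilpotent part of `L_W(0)`. -/
def zL0bar {A : GRVA V} (M : GRMod V W A) (z : ℂ) (ω : WbarT M) : WbarT M := fun c =>
  Complex.exp (Complex.log z * c) •
    ∑ᶠ K : ℕ, (((Complex.log z) ^ K * ((K.factorial : ℂ))⁻¹) •
      (⟨((M.L0 - c • 1) ^ K) (ω c : W), L0nil_mem M K c _ (ω c).2⟩ : M.grading c))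

/-- The operator `z^{L_V(0)}` on `V` (semisimple, integral weights). -/
def zL0V (A : GRVA V) (z : ℂ) (v : V) : V :=
  letI := A.decomp
  ∑ᶠ k : ℤ, (z ^ k) • ((DirectSum.decompose A.grading v k : V))

/-! ## The `L(-1)`-derivative and `L(0)`-conjugation properties -/

/-- The `L(-1)`-derivative property for a cochain `Φ`. -/
def HasL1D {A : GRVA V} {M : GRMod V W A} {n : ℕ} (Φ : Cochain M n) : Prop :=
  (∀ (v : Fin n → V) (w' : W →ₗ[ℂ] ℂ), GradedFunctionalC M.grading w' →
    ∀ (i : Fin n) (z : Fin n → ℂ), (∀ s t, s ≠ t → z s ≠ z t) →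
      HasDerivAt (fun t => pairBar w' (Φ v (Function.update z i t)))
        (pairBar w' (Φ (Function.update v i (A.Lm1 (v i))) z)) (z i)) ∧
  (∀ (v : Fin n → V) (w' : W →ₗ[ℂ] ℂ), GradedFunctionalC M.grading w' →
    ∀ z : Fin n → ℂ, (∀ s t, s ≠ t → z s ≠ z t) →
      ∑ i : Fin n, pairBar w' (Φ (Function.update v i (A.Lm1 (v i))) z)
        = pairBar w' (Lm1bar M (Φ v z)))

/-- The `L(0)`-conjugation property for a cochain `Φ`. -/
def HasL0conj {A : GRVA V} {M : GRMod V W A} {n : ℕ} (Φ : Cochain M n) : Prop :=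
  ∀ (v : Fin n → V) (w' : W →ₗ[ℂ] ℂ), GradedFunctionalC M.grading w' →
    ∀ (z : ℂ) (zs : Fin n → ℂ), z ≠ 0 → (∀ s t, s ≠ t → zs s ≠ zs t) →
      pairBar w' (zL0bar M z (Φ v zs))
        = pairBar w' (Φ (fun i => zL0V A z (v i)) (fun i => z * zs i))
/-! ## Block embeddings -/

/-- Starting index of the `i`-th block of sizes `l`. -/
def blockStart {n : ℕ} (l : Fin n → ℕ) (i : Fin n) : ℕ :=
  ∑ j ∈ Finset.univ.filter (fun j => j < i), l j

lemma blockEmb_lt {n m : ℕ} (l : Fin n → ℕ) (hsum : ∑ i, l i = m) (i : Fin n)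
    (p : Fin (l i)) : blockStart l i + (p : ℕ) < m := by
  have hp : (p : ℕ) < l i := p.2
  have h2 : blockStart l i + l i ≤ m := by
    rw [← hsum]
    have hnotin : i ∉ Finset.univ.filter (fun j => j < i) := by simp
    have : blockStart l i + l i = ∑ j ∈ insert i (Finset.univ.filter (fun j => j < i)), l j := by
      rw [Finset.sum_insert hnotin, Nat.add_comm]; rfl
    rw [this]
    exact Finset.sum_le_sum_of_subset (by intro x _; simp)
  omega

/-- The embedding of the `p`-th position of the `i`-th block into `Fin m`,
where the blocks have sizes `l 0, …, l (n-1)` with `∑ l = m`. -/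
def blockEmb {n m : ℕ} (l : Fin n → ℕ) (hsum : ∑ i, l i = m) (i : Fin n)
    (p : Fin (l i)) : Fin m :=
  ⟨blockStart l i + (p : ℕ), blockEmb_lt l hsum i p⟩

/-! ## Composability with vertex operators -/

/-- `Φ : V^{⊗n} → W̃` is composable with `m` vertex operators (Definition 3.3):
the two families of series obtained by substituting products of vertex operators
acting on the vacuum into the arguments of `Φ` (condition 1) and by applying `m`
module vertex operators to the value of `Φ` (condition 2) converge absolutely in
the indicated regions to rational functions with only possible poles at
`z i = z j` of orders bounded by positive integers `N(v i, v j)` depending only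
on `v i` and `v j`.  The auxiliary `V̄`- and `W̄`-valued products are encoded by
families `EV`, `EW` satisfying `IsEVFam`, `IsEWFam`. -/
def Composable {A : GRVA V} {M : GRMod V W A}
    (EV : ∀ l : ℕ, (Fin l → V) → (Fin l → ℂ) → VbarT A)
    (EW : ∀ m : ℕ, (Fin m → V) → W → (Fin m → ℂ) → WbarT M)
    {n : ℕ} (m : ℕ) (Φ : Cochain M n) : Prop :=
  (∃ Nb : V → V → ℕ, (∀ a b, 0 < Nb a b) ∧
    ∀ (l : Fin n → ℕ), (∀ i, 0 < l i) → ∀ (hsum : ∑ i, l i = m + n)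
      (v : Fin (m + n) → V) (w' : W →ₗ[ℂ] ℂ), GradedFunctionalC M.grading w' →
    ∃ f : (Fin (m + n) → ℂ) → ℂ,
      RatDiagBnd (m + n) (fun s t => Nb (v s) (v t)) f ∧
      ∀ (ζ : Fin n → ℂ) (z : Fin (m + n) → ℂ),
        (∀ i j : Fin n, i ≠ j → ζ i ≠ ζ j) →
        (∀ i j : Fin n, i ≠ j → ∀ (p : Fin (l i)) (q : Fin (l j)),
          ‖z (blockEmb l hsum i p) - ζ i‖ + ‖z (blockEmb l hsum j q) - ζ j‖
            < ‖ζ i - ζ j‖) →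
        (∀ (i : Fin n) (p q : Fin (l i)), p ≠ q →
          z (blockEmb l hsum i p) ≠ z (blockEmb l hsum i q)) →
        HasSum (fun r : Fin n → ℤ =>
          pairBar w' (Φ (fun i =>
            ((EV (l i) (fun p => v (blockEmb l hsum i p))
              (fun p => z (blockEmb l hsum i p) - ζ i)) (r i) : V)) ζ)) (f z)) ∧
  (∃ Nb : V → V → ℕ, (∀ a b, 0 < Nb a b) ∧
    ∀ (v : Fin (m + n) → V) (w' : W →ₗ[ℂ] ℂ), GradedFunctionalC M.grading w' →
    ∃ f : (Fin (m + n) → ℂ) → ℂ,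
      RatDiagBnd (m + n) (fun s t => Nb (v s) (v t)) f ∧
      ∀ z : Fin (m + n) → ℂ, (∀ s t, s ≠ t → z s ≠ z t) →
        (∀ (i : Fin m) (j : Fin n), ‖z (Fin.castAdd n i)‖ > ‖z (Fin.natAdd m j)‖) →
        (∀ j : Fin n, z (Fin.natAdd m j) ≠ 0) →
        HasSum (fun q : ℂ =>
          pairBar w' (EW m (fun i => v (Fin.castAdd n i))
            ((Φ (fun j => v (Fin.natAdd m j)) (fun j => z (Fin.natAdd m j)) q : W))
            (fun i => z (Fin.castAdd n i)))) (f z))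

/-- `Ψ` realizes the composition `Φ ∘ (E^{(l₁)}_{V;𝟏} ⊗ ⋯ ⊗ E^{(lₙ)}_{V;𝟏})`,
defined through the absolutely convergent series of condition 1 of composability
and rational extension. -/
def IsCompE {A : GRVA V} {M : GRMod V W A}
    (EV : ∀ l : ℕ, (Fin l → V) → (Fin l → ℂ) → VbarT A)
    {n : ℕ} (Φ : Cochain M n) (m' : ℕ) (l : Fin n → ℕ) (hsum : ∑ i, l i = m')
    (Ψ : Cochain M m') : Prop :=
  ∀ (v : Fin m' → V) (w' : W →ₗ[ℂ] ℂ), GradedFunctionalC M.grading w' →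
    RatDiag m' (fun z => pairBar w' (Ψ v z)) ∧
    ∀ (ζ : Fin n → ℂ) (z : Fin m' → ℂ),
      (∀ i j : Fin n, i ≠ j → ζ i ≠ ζ j) →
      (∀ s t : Fin m', s ≠ t → z s ≠ z t) →
      (∀ i j : Fin n, i ≠ j → ∀ (p : Fin (l i)) (q : Fin (l j)),
        ‖z (blockEmb l hsum i p) - ζ i‖ + ‖z (blockEmb l hsum j q) - ζ j‖
          < ‖ζ i - ζ j‖) →
      HasSum (fun r : Fin n → ℤ =>
        pairBar w' (Φ (fun i =>
          ((EV (l i) (fun p => v (blockEmb l hsum i p))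
            (fun p => z (blockEmb l hsum i p) - ζ i)) (r i) : V)) ζ))
        (pairBar w' (Ψ v z))

/-- `Ψ` realizes the composition `E^{(p)}_W ∘_{p+1} Φ` (applying `p` module vertex
operators to the left of the value of `Φ`), defined through the absolutely
convergent series of condition 2 of composability and rational extension. -/
def IsCompW {A : GRVA V} {M : GRMod V W A}
    (EW : ∀ m : ℕ, (Fin m → V) → W → (Fin m → ℂ) → WbarT M)
    {n : ℕ} (Φ : Cochain M n) (p : ℕ) (Ψ : Cochain M (p + n)) : Prop :=
  ∀ (v : Fin (p + n) → V) (w' : W →ₗ[ℂ] ℂ), GradedFunctionalC M.grading w' →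
    RatDiag (p + n) (fun z => pairBar w' (Ψ v z)) ∧
    ∀ z : Fin (p + n) → ℂ, (∀ s t, s ≠ t → z s ≠ z t) →
      (∀ (i : Fin p) (j : Fin n), ‖z (Fin.castAdd n i)‖ > ‖z (Fin.natAdd p j)‖) →
      (∀ j : Fin n, z (Fin.natAdd p j) ≠ 0) →
      HasSum (fun q : ℂ =>
        pairBar w' (EW p (fun i => v (Fin.castAdd n i))
          ((Φ (fun j => v (Fin.natAdd p j)) (fun j => z (Fin.natAdd p j)) q : W))
          (fun i => z (Fin.castAdd n i)))) (pairBar w' (Ψ v z))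

/-- `Ψ` realizes the composition `E^{W;(m)}_{WV} ∘₀ Φ` (substituting the value of
`Φ` into the `W`-argument of `E^{W;(m)}_{WV} = E^{W;(1,m)}_{WV}(·)(0, ·)`). -/
def IsCompWV {A : GRVA V} {M : GRMod V W A}
    (G : ∀ m : ℕ, W → (Fin m → V) → (Fin (m + 1) → ℂ) → WbarT M)
    {n : ℕ} (Φ : Cochain M n) (m : ℕ) (Ψ : Cochain M (n + m)) : Prop :=
  ∀ (v : Fin (n + m) → V) (w' : W →ₗ[ℂ] ℂ), GradedFunctionalC M.grading w' →
    RatDiag (n + m) (fun z => pairBar w' (Ψ v z)) ∧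
    ∀ z : Fin (n + m) → ℂ, (∀ s t, s ≠ t → z s ≠ z t) →
      (∀ (j : Fin m) (i : Fin n), ‖z (Fin.natAdd n j)‖ > ‖z (Fin.castAdd m i)‖) →
      (∀ i : Fin n, z (Fin.castAdd m i) ≠ 0) →
      HasSum (fun q : ℂ =>
        pairBar w' (G m
          ((Φ (fun i => v (Fin.castAdd m i)) (fun i => z (Fin.castAdd m i)) q : W))
          (fun j => v (Fin.natAdd n j))
          (Fin.cons 0 (fun j => z (Fin.natAdd n j)))))
        (pairBar w' (Ψ v z))
/-! ## Shuffles -/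

/-- `σ ∈ J_{n;p}`: `σ` preserves the order of the first `p` positions and of the
last `n - p` positions (0-indexed). -/
def IsShuffle {n : ℕ} (p : ℕ) (σ : Equiv.Perm (Fin n)) : Prop :=
  (∀ s t : Fin n, s < t → (t : ℕ) < p → σ s < σ t) ∧
  (∀ s t : Fin n, s < t → p ≤ (s : ℕ) → σ s < σ t)

/-- The shuffle condition defining the subcomplex `C^n_•(V,W)`: for every
`1 ≤ p ≤ n-1` the signed sum over shuffles of the permuted cochains vanishes
on the configuration space. -/
def ShuffleVanish {A : GRVA V} {M : GRMod V W A} {n : ℕ} (Φ : Cochain M n) : Prop :=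
  ∀ p : ℕ, 1 ≤ p → p ≤ n - 1 →
    ∀ (v : Fin n → V) (z : Fin n → ℂ), (∀ s t, s ≠ t → z s ≠ z t) →
      ∑ σ ∈ Finset.univ.filter (fun σ : Equiv.Perm (Fin n) => IsShuffle p σ),
        ((Equiv.Perm.sign σ : ℤ) : ℂ) • (transport σ Φ) v z = 0

/-! ## The coboundary operator -/

lemma sum_delta_block (n : ℕ) (i : Fin n) :
    ∑ j : Fin n, (if j = i then 2 else 1) = n + 1 := by
  have h : ∀ j : Fin n, (if j = i then 2 else 1) = (if j = i then 1 else 0) + 1 := by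
    intro j; split <;> rfl
  simp only [h, Finset.sum_add_distrib, Finset.sum_ite_eq' Finset.univ i (fun _ => 1)]
  simp [Nat.add_comm]

/-- `Θ` is a realization of the coboundary
`δ̂ⁿ(Φ) = E^{(1)}_W ∘₂ Φ + ∑_{i=1}^n (-1)^i Φ ∘ᵢ E^{(2)}_{V;𝟏}
          + (-1)^{n+1} E^{W;(1)}_{WV} ∘₀ Φ`
on the configuration space, where the three kinds of compositions are encoded by
the predicates `IsCompW`, `IsCompE`, `IsCompWV`. -/
def IsDelta {A : GRVA V} {M : GRMod V W A}
    (EV : ∀ l : ℕ, (Fin l → V) → (Fin l → ℂ) → VbarT A)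
    (EW : ∀ m : ℕ, (Fin m → V) → W → (Fin m → ℂ) → WbarT M)
    (G : ∀ m : ℕ, W → (Fin m → V) → (Fin (m + 1) → ℂ) → WbarT M)
    {n : ℕ} (Φ : Cochain M n) (Θ : Cochain M (n + 1)) : Prop :=
  ∃ (Aw : Cochain M (1 + n)) (B : Fin n → Cochain M (n + 1)) (Cw : Cochain M (n + 1)),
    IsCompW EW Φ 1 Aw ∧
    (∀ i : Fin n, IsCompE EV Φ (n + 1) (fun j => if j = i then 2 else 1)
      (sum_delta_block n i) (B i)) ∧
    IsCompWV G Φ 1 Cw ∧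
    (∀ (v : Fin (n + 1) → V) (z : Fin (n + 1) → ℂ), (∀ s t, s ≠ t → z s ≠ z t) →
      Θ v z = (transport (finCongr (Nat.add_comm 1 n)) Aw) v z
        + (∑ i : Fin n, ((-1 : ℂ) ^ ((i : ℕ) + 1)) • B i) v z
        + (((-1 : ℂ) ^ (n + 1)) • Cw) v z)

/-- Membership in `Ĉⁿₘ(V,W)` (before imposing the shuffle condition):
`W̃`-valued rationality, the `L(-1)`-derivative and `L(0)`-conjugation properties,
and composability with `m` vertex operators. -/
def HatCmem {A : GRVA V} {M : GRMod V W A}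
    (EV : ∀ l : ℕ, (Fin l → V) → (Fin l → ℂ) → VbarT A)
    (EW : ∀ m : ℕ, (Fin m → V) → W → (Fin m → ℂ) → WbarT M)
    {n : ℕ} (m : ℕ) (Φ : Cochain M n) : Prop :=
  TakesRatValues Φ ∧ HasL1D Φ ∧ HasL0conj Φ ∧ Composable EV EW m Φ

/-- Membership in `Cⁿₘ(V,W)`: membership in `Ĉⁿₘ(V,W)` together with the
vanishing of all shuffle sums. -/
def Cmem {A : GRVA V} {M : GRMod V W A}
    (EV : ∀ l : ℕ, (Fin l → V) → (Fin l → ℂ) → VbarT A)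
    (EW : ∀ m : ℕ, (Fin m → V) → W → (Fin m → ℂ) → WbarT M)
    {n : ℕ} (m : ℕ) (Φ : Cochain M n) : Prop :=
  HatCmem EV EW m Φ ∧ ShuffleVanish Φ
/-! ## The extra second coboundary `δ̂²_{1/2}` -/

/-- The data of the two combined absolutely convergent series (and their rational
extensions `f`, `g`) entering the definition of `Ĉ²_{1/2}(V,W)` and of
`δ̂²_{1/2}` for a 2-cochain `Φ`, for fixed `v₁,v₂,v₃` and `w'`. -/
def HalfDeltaData {A : GRVA V} {M : GRMod V W A}
    (EV : ∀ l : ℕ, (Fin l → V) → (Fin l → ℂ) → VbarT A)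
    (En1 : ∀ m : ℕ, (Fin m → V) → W → (Fin (m + 1) → ℂ) → WbarT M)
    (G : ∀ m : ℕ, W → (Fin m → V) → (Fin (m + 1) → ℂ) → WbarT M)
    (Φ : Cochain M 2) (v : Fin 3 → V) (w' : W →ₗ[ℂ] ℂ)
    (f g : (Fin 3 → ℂ) → ℂ) : Prop :=
  RatFull 3 f ∧ RatFull 3 g ∧
  (∀ z₁ z₂ z₃ ζ : ℂ, ‖z₁ - ζ‖ > ‖z₂ - ζ‖ → ‖z₁ - ζ‖ > ‖z₃ - ζ‖ →
      z₂ ≠ ζ → z₃ ≠ ζ → z₂ ≠ z₃ → z₁ ≠ ζ →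
    HasSum (fun r : ℂ =>
      pairBar w' (En1 1 ![v 0] ((Φ ![v 1, v 2] ![z₂ - ζ, z₃ - ζ]) r : W) ![z₁, ζ])
      + pairBar w' (Φ ![v 0, VbarComp (EV 2 ![v 1, v 2] ![z₂ - ζ, z₃ - ζ]) r] ![z₁, ζ]))
      (f ![z₁, z₂, z₃])) ∧
  (∀ z₁ z₂ z₃ ζ : ℂ, ‖ζ - z₃‖ > ‖z₁ - ζ‖ → ‖ζ - z₃‖ > ‖z₂ - ζ‖ →
      z₁ ≠ ζ → z₂ ≠ ζ → z₁ ≠ z₂ → ζ ≠ z₃ →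
    HasSum (fun r : ℂ =>
      pairBar w' (Φ ![VbarComp (EV 2 ![v 0, v 1] ![z₁ - ζ, z₂ - ζ]) r, v 2] ![ζ, z₃])
      + pairBar w' (G 1 ((Φ ![v 0, v 1] ![z₁ - ζ, z₂ - ζ]) r : W) ![v 2] ![ζ, z₃]))
      (g ![z₁, z₂, z₃]))

/-- Membership in `Ĉ²_{1/2}(V,W)`: the two combined series converge absolutely to
rational functions with the only possible poles at `zᵢ = zⱼ` and `zᵢ = 0`. -/
def HalfComposable {A : GRVA V} {M : GRMod V W A}
    (EV : ∀ l : ℕ, (Fin l → V) → (Fin l → ℂ) → VbarT A)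
    (En1 : ∀ m : ℕ, (Fin m → V) → W → (Fin (m + 1) → ℂ) → WbarT M)
    (G : ∀ m : ℕ, W → (Fin m → V) → (Fin (m + 1) → ℂ) → WbarT M)
    (Φ : Cochain M 2) : Prop :=
  ∀ (v : Fin 3 → V) (w' : W →ₗ[ℂ] ℂ), GradedFunctionalC M.grading w' →
    ∃ f g : (Fin 3 → ℂ) → ℂ, HalfDeltaData EV En1 G Φ v w' f g

/-- `Ξ` realizes `δ̂²_{1/2}(Φ)`: the difference of the rational extensions of
the two combined series. -/
def IsDeltaHalf {A : GRVA V} {M : GRMod V W A}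
    (EV : ∀ l : ℕ, (Fin l → V) → (Fin l → ℂ) → VbarT A)
    (En1 : ∀ m : ℕ, (Fin m → V) → W → (Fin (m + 1) → ℂ) → WbarT M)
    (G : ∀ m : ℕ, W → (Fin m → V) → (Fin (m + 1) → ℂ) → WbarT M)
    (Φ : Cochain M 2) (Ξ : Cochain M 3) : Prop :=
  ∀ (v : Fin 3 → V) (w' : W →ₗ[ℂ] ℂ), GradedFunctionalC M.grading w' →
    ∃ f g : (Fin 3 → ℂ) → ℂ, HalfDeltaData EV En1 G Φ v w' f g ∧
      ∀ z : Fin 3 → ℂ, (∀ s t, s ≠ t → z s ≠ z t) →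
        pairBar w' (Ξ v z) = f z - g z

/-! ## Cocycles and coboundaries -/

/-- `Φ ∈ C^n_m(V,W)` is a cocycle: every realization of `δ̂ⁿₘ(Φ)` vanishes on the
configuration space. -/
def IsCocycle {A : GRVA V} {M : GRMod V W A}
    (EV : ∀ l : ℕ, (Fin l → V) → (Fin l → ℂ) → VbarT A)
    (EW : ∀ m : ℕ, (Fin m → V) → W → (Fin m → ℂ) → WbarT M)
    (G : ∀ m : ℕ, W → (Fin m → V) → (Fin (m + 1) → ℂ) → WbarT M)
    {n : ℕ} (m : ℕ) (Φ : Cochain M n) : Prop :=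
  Cmem EV EW m Φ ∧
    ∀ Θ : Cochain M (n + 1), IsDelta EV EW G Φ Θ →
      ∀ (v : Fin (n + 1) → V) (z : Fin (n + 1) → ℂ),
        (∀ s t, s ≠ t → z s ≠ z t) → Θ v z = 0

/-- `Φ` is a coboundary at level `m`: it agrees on the configuration space with a
realization of `δ̂ⁿ_{m+1}(Ψ)` for some `Ψ ∈ Cⁿ_{m+1}(V,W)`. -/
def IsCobound {A : GRVA V} {M : GRMod V W A}
    (EV : ∀ l : ℕ, (Fin l → V) → (Fin l → ℂ) → VbarT A)
    (EW : ∀ m : ℕ, (Fin m → V) → W → (Fin m → ℂ) → WbarT M)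
    (G : ∀ m : ℕ, W → (Fin m → V) → (Fin (m + 1) → ℂ) → WbarT M)
    {n : ℕ} (m : ℕ) (Φ : Cochain M (n + 1)) : Prop :=
  ∃ Ψ : Cochain M n, Cmem EV EW (m + 1) Ψ ∧
    ∃ Θ : Cochain M (n + 1), IsDelta EV EW G Ψ Θ ∧
      ∀ (v : Fin (n + 1) → V) (z : Fin (n + 1) → ℂ),
        (∀ s t, s ≠ t → z s ≠ z t) → Θ v z = Φ v z

/-! ## Iterated Laurent series in two variables -/

lemma hasSum_of_forall_eq {ι : Type*} {f g : ι → ℂ} {a : ℂ} (hf : HasSum f a)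
    (h : ∀ i, g i = f i) : HasSum g a := by
  rwa [show g = f from funext h]

/-- Uniqueness of the coefficients of a lower-truncated Laurent series. -/
lemma laurent_coeff_eq_zero {b : ℤ → ℂ} {N : ℤ} (hb : ∀ k < N, b k = 0) {ε : ℝ} (hε : 0 < ε)
    (h : ∀ s : ℂ, s ≠ 0 → ‖s‖ < ε → HasSum (fun k : ℤ => s ^ k * b k) 0) (k : ℤ) : b k = 0 := by
  have hinj : Function.Injective (fun n : ℕ => N + (n : ℤ)) := fun m n hmn => by
    simpa using hmn
  have hnat : ∀ s : ℂ, s ≠ 0 → ‖s‖ < ε → HasSum (fun n : ℕ => b (N + n) * s ^ n) 0 := by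
    intro s hs hsε
    have h1 := (hinj.hasSum_iff (f := fun k : ℤ => s ^ k * b k) (a := 0) (by
      intro k hk
      have : k < N := by
        by_contra hlt
        exact hk ⟨(k - N).toNat, by simp; omega⟩
      simp [hb k this])).2 (h s hs hsε)
    have h2 := h1.mul_left (s ^ (-N))
    rw [mul_zero] at h2
    refine hasSum_of_forall_eq h2 fun n => ?_
    rw [Function.comp_apply, ← mul_assoc, ← zpow_add₀ hs, neg_add_cancel_left, zpow_natCast, mul_comm]
  set c : ℕ → ℂ := fun n => b (N + n) with hc
  set P := FormalMultilinearSeries.ofScalars ℂ c with hP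
  have hrad : 0 < P.radius := by
    have hε2 : (0 : ℝ) ≤ ε / 2 := by positivity
    refine lt_of_lt_of_le ?_ (P.le_radius_of_tendsto (r := (ε / 2).toNNReal) (l := 0) ?_)
    · rw [ENNReal.coe_pos, Real.toNNReal_pos]
      positivity
    · have hs : ((ε / 2 : ℝ) : ℂ) ≠ 0 := by
        exact_mod_cast (by positivity : ε / 2 ≠ 0)
      have hn : ‖((ε / 2 : ℝ) : ℂ)‖ = ε / 2 := by
        rw [Complex.norm_real, Real.norm_of_nonneg hε2]
      have := (hnat _ hs (by rw [hn]; linarith)).summable.tendsto_atTop_zero.norm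
      simp only [norm_mul, norm_pow, hn, norm_zero] at this
      simpa only [hP, FormalMultilinearSeries.ofScalars_norm, Real.coe_toNNReal _ hε2] using this
  have hball := P.hasFPowerSeriesOnBall hrad
  have hzero : ∀ᶠ s in nhdsWithin (0 : ℂ) {0}ᶜ, P.sum s = 0 := by
    have hb' : Metric.ball (0 : ℂ) ε ∈ nhdsWithin (0 : ℂ) {0}ᶜ :=
      mem_nhdsWithin_of_mem_nhds (Metric.ball_mem_nhds _ hε)
    filter_upwards [hb', self_mem_nhdsWithin] with s hs hs0
    have := (hnat s hs0 (by simpa using hs)).tsum_eq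
    have h3 := FormalMultilinearSeries.ofScalars_sum_eq (E := ℂ) c s
    simp only [smul_eq_mul] at h3
    rw [this] at h3
    exact h3
  have hzero' := (AnalyticAt.frequently_zero_iff_eventually_zero
    hball.analyticAt).1 hzero.frequently
  have hP0 := hball.hasFPowerSeriesAt.eq_zero_of_eventually hzero'
  have hc0 : c = 0 := (FormalMultilinearSeries.ofScalars_series_eq_zero (E := ℂ)).1 hP0
  by_cases hk : k < N
  · exact hb k hk
  · have := congrFun hc0 (k - N).toNat
    rw [hc] at this
    simpa [show N + ((k - N).toNat : ℤ) = k by omega, show N + max (k - N) 0 = k by omega]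
      using this

/-- `f s τ` is the iterated sum `∑ᵢ sⁱ (∑ⱼ τʲ b i j)` of a lower-truncated double family, for
all small nonzero `s` and `τ`. -/
def IterSum (ε : ℝ) (b : ℤ → ℤ → ℂ) (f : ℂ → ℂ → ℂ) : Prop :=
  (∃ N : ℤ, ∀ i j, i < N ∨ j < N → b i j = 0) ∧
  ∃ B : ℤ → ℂ → ℂ,
    (∀ τ : ℂ, τ ≠ 0 → ‖τ‖ < ε → ∀ i, HasSum (fun j : ℤ => τ ^ j * b i j) (B i τ)) ∧
    ∀ s τ : ℂ, s ≠ 0 → ‖s‖ < ε → τ ≠ 0 → ‖τ‖ < ε →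
      HasSum (fun i : ℤ => s ^ i * B i τ) (f s τ)

namespace IterSum

variable {ε : ℝ} {b b' : ℤ → ℤ → ℂ} {f f' : ℂ → ℂ → ℂ}

lemma congr_fun_of_small (h : IterSum ε b f)
    (hf : ∀ s τ : ℂ, s ≠ 0 → ‖s‖ < ε → τ ≠ 0 → ‖τ‖ < ε → f s τ = f' s τ) : IterSum ε b f' := by
  obtain ⟨hN, B, hB, hs⟩ := h
  exact ⟨hN, B, hB, fun s τ h1 h2 h3 h4 => hf s τ h1 h2 h3 h4 ▸ hs s τ h1 h2 h3 h4⟩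

lemma eq_zero (hε : 0 < ε) (h : IterSum ε b 0) (i j : ℤ) : b i j = 0 := by
  obtain ⟨⟨N, hN⟩, B, hB, hs⟩ := h
  refine laurent_coeff_eq_zero (N := N) (fun j hj => hN i j (Or.inr hj)) hε ?_ j
  intro τ hτ hτε
  have hBi : B i τ = 0 := by
    refine laurent_coeff_eq_zero (b := fun i => B i τ) (N := N) (fun i hi => ?_) hε ?_ i
    · have h1 := hB τ hτ hτε i
      simp only [hN i _ (Or.inl hi), mul_zero] at h1
      exact h1.unique hasSum_zero
    · exact fun s h1 h2 => hs s τ h1 h2 hτ hτε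
  exact hBi ▸ hB τ hτ hτε i

lemma zero : IterSum ε 0 0 :=
  ⟨⟨0, fun _ _ _ => rfl⟩, 0, fun τ _ _ i => by simp,
    fun s τ _ _ _ _ => by simp⟩

lemma add (h : IterSum ε b f) (h' : IterSum ε b' f') : IterSum ε (b + b') (f + f') := by
  obtain ⟨⟨N, hN⟩, B, hB, hs⟩ := h
  obtain ⟨⟨N', hN'⟩, B', hB', hs'⟩ := h'
  refine ⟨⟨min N N', fun i j hij => ?_⟩, fun i τ => B i τ + B' i τ, ?_, ?_⟩
  · have h1 : i < N ∨ j < N := by omega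
    have h2 : i < N' ∨ j < N' := by omega
    simp [hN i j h1, hN' i j h2]
  · intro τ h1 h2 i
    simpa [mul_add] using (hB τ h1 h2 i).add (hB' τ h1 h2 i)
  · intro s τ h1 h2 h3 h4
    simpa [mul_add] using (hs s τ h1 h2 h3 h4).add (hs' s τ h1 h2 h3 h4)

lemma monomial_mul (h : IterSum ε b f) (c : ℂ) (d e : ℤ) :
    IterSum ε (fun i j => c * b (i - d) (j - e)) (fun s τ => c * s ^ d * τ ^ e * f s τ) := by
  obtain ⟨⟨N, hN⟩, B, hB, hs⟩ := h
  refine ⟨⟨N + min d e, fun i j hij => ?_⟩, fun i τ => c * τ ^ e * B (i - d) τ, ?_, ?_⟩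
  · show c * b (i - d) (j - e) = 0
    rw [hN _ _ (by omega), mul_zero]
  · intro τ h1 h2 i
    have := ((hB τ h1 h2 (i - d)).mul_left (c * τ ^ e))
    rw [← (Equiv.subRight e).hasSum_iff] at this
    refine hasSum_of_forall_eq this fun j => ?_
    rw [Function.comp_apply, Equiv.subRight_apply, zpow_sub₀ h1]
    field_simp
  · intro s τ h1 h2 h3 h4
    have := ((hs s τ h1 h2 h3 h4).mul_left (c * s ^ d * τ ^ e))
    rw [← (Equiv.subRight d).hasSum_iff] at this
    refine hasSum_of_forall_eq this fun i => ?_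
    rw [Function.comp_apply, Equiv.subRight_apply, zpow_sub₀ h1]
    field_simp

lemma laurent_mul {ι : Type*} (h : IterSum ε b f) (S : Finset ι) (c : ι → ℂ) (d e : ι → ℤ) :
    IterSum ε (fun i j => ∑ k ∈ S, c k * b (i - d k) (j - e k))
      (fun s τ => (∑ k ∈ S, c k * s ^ d k * τ ^ e k) * f s τ) := by
  induction S using Finset.induction_on with
  | empty =>
    simp only [Finset.sum_empty, zero_mul]
    exact zero
  | insert k S hk ih =>
    convert (h.monomial_mul (c k) (d k) (e k)).add ih using 1
    · funext i j; simp [Finset.sum_insert hk]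
    · funext s τ; simp [Finset.sum_insert hk, add_mul]

lemma one : IterSum ε (fun i j => if i = 0 ∧ j = 0 then 1 else 0) (fun _ _ => 1) := by
  refine ⟨⟨0, fun i j hij => if_neg (by omega)⟩, fun i _ => if i = 0 then 1 else 0, ?_, ?_⟩
  · intro τ _ _ i
    convert hasSum_ite_eq (0 : ℤ) (if i = 0 then (1 : ℂ) else 0) using 2 with j
    by_cases hj : j = 0 <;> simp [hj]
  · intro s τ _ _ _ _
    convert hasSum_ite_eq (0 : ℤ) (1 : ℂ) using 2 with j
    by_cases hj : j = 0 <;> simp [hj]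

end IterSum

/-- `f` is a Laurent polynomial function of two nonzero variables. -/
def IsLaurent (f : ℂ → ℂ → ℂ) : Prop :=
  ∃ c : ℤ × ℤ →₀ ℂ, ∀ s τ : ℂ, s ≠ 0 → τ ≠ 0 →
    f s τ = ∑ k ∈ c.support, c k * s ^ k.1 * τ ^ k.2

namespace IsLaurent

variable {f g : ℂ → ℂ → ℂ}

lemma monomial (a : ℂ) (d e : ℤ) : IsLaurent (fun s τ => a * s ^ d * τ ^ e) := by
  refine ⟨Finsupp.single (d, e) a, fun s τ _ _ => ?_⟩
  change _ = (Finsupp.single (d, e) a).sum fun k x => x * s ^ k.1 * τ ^ k.2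
  rw [Finsupp.sum_single_index (by simp)]

lemma congr (hf : IsLaurent f) (h : ∀ s τ, f s τ = g s τ) : IsLaurent g := by
  rwa [show g = f from funext fun s => funext fun τ => (h s τ).symm]

lemma add (hf : IsLaurent f) (hg : IsLaurent g) : IsLaurent (fun s τ => f s τ + g s τ) := by
  obtain ⟨c, hc⟩ := hf
  obtain ⟨c', hc'⟩ := hg
  refine ⟨c + c', fun s τ hs hτ => ?_⟩
  change _ = (c + c').sum fun k x => x * s ^ k.1 * τ ^ k.2
  beta_reduce
  rw [hc s τ hs hτ, hc' s τ hs hτ, Finsupp.sum_add_index' (by simp) (by intros; ring)]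
  rfl

lemma sum {ι : Type*} (S : Finset ι) {F : ι → ℂ → ℂ → ℂ} (h : ∀ k, IsLaurent (F k)) :
    IsLaurent (fun s τ => ∑ k ∈ S, F k s τ) := by
  induction S using Finset.induction_on with
  | empty => exact (monomial 0 0 0).congr (by simp)
  | insert k S hk ih => exact ((h k).add ih).congr fun s τ => by simp [Finset.sum_insert hk]

lemma monomial_mul (hf : IsLaurent f) (a : ℂ) (d e : ℤ) :
    IsLaurent (fun s τ => a * s ^ d * τ ^ e * f s τ) := by
  obtain ⟨c, hc⟩ := hf
  obtain ⟨c', hc'⟩ := sum c.support fun k => monomial (a * c k) (d + k.1) (e + k.2)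
  refine ⟨c', fun s τ hs hτ => ?_⟩
  rw [← hc' s τ hs hτ]
  beta_reduce
  rw [hc s τ hs hτ, Finset.mul_sum]
  refine Finset.sum_congr rfl fun k _ => ?_
  rw [zpow_add₀ hs, zpow_add₀ hτ]
  ring

lemma mul (hf : IsLaurent f) (hg : IsLaurent g) : IsLaurent (fun s τ => f s τ * g s τ) := by
  obtain ⟨c, hc⟩ := hf
  obtain ⟨c', hc'⟩ := sum c.support fun k => hg.monomial_mul (c k) k.1 k.2
  refine ⟨c', fun s τ hs hτ => ?_⟩
  rw [← hc' s τ hs hτ]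
  beta_reduce
  rw [hc s τ hs hτ, Finset.sum_mul]

lemma eval_mvPolynomial {σ : Type*} {z : ℂ → ℂ → σ → ℂ} (hz : ∀ t, IsLaurent fun s τ => z s τ t)
    (P : MvPolynomial σ ℂ) : IsLaurent (fun s τ => MvPolynomial.eval (z s τ) P) := by
  induction P using MvPolynomial.induction_on with
  | C a => exact (monomial a 0 0).congr (by simp)
  | add p q hp hq => exact (hp.add hq).congr (by simp)
  | mul_X p t hp => exact (hp.mul (hz t)).congr (by simp)

end IsLaurent

/-- If two functions are iterated sums of the same double family, one in each order, and both
become Laurent polynomials after multiplication by a common Laurent polynomial, then these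
Laurent polynomials coincide. -/
lemma IterSum.laurent_eq {ε : ℝ} (hε : 0 < ε) {b : ℤ → ℤ → ℂ} {G H D p p' : ℂ → ℂ → ℂ}
    (hG : IterSum ε b G) (hH : IterSum ε (fun j i => b i j) (fun τ s => H s τ))
    (hD : IsLaurent D) (hp : IsLaurent p) (hp' : IsLaurent p')
    (hGp : ∀ s τ : ℂ, s ≠ 0 → ‖s‖ < ε → τ ≠ 0 → ‖τ‖ < ε → D s τ * G s τ = p s τ)
    (hHp : ∀ s τ : ℂ, s ≠ 0 → ‖s‖ < ε → τ ≠ 0 → ‖τ‖ < ε → D s τ * H s τ = p' s τ)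
    {s τ : ℂ} (hs : s ≠ 0) (hτ : τ ≠ 0) : p s τ = p' s τ := by
  obtain ⟨c, hc⟩ := hD
  obtain ⟨a, ha⟩ := hp
  obtain ⟨a', ha'⟩ := hp'
  have key1 := (hG.laurent_mul c.support c Prod.fst Prod.snd).add
    (IterSum.one.laurent_mul a.support (fun k => -a k) Prod.fst Prod.snd)
  have key2 := (hH.laurent_mul c.support c Prod.snd Prod.fst).add
    (IterSum.one.laurent_mul a'.support (fun k => -a' k) Prod.snd Prod.fst)
  have z1 := (key1.congr_fun_of_small (f' := 0) (by
    intro s τ h1 h2 h3 h4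
    have h5 := hGp s τ h1 h2 h3 h4
    rw [hc s τ h1 h3, ha s τ h1 h3] at h5
    simp [h5])).eq_zero hε
  have z2 := (key2.congr_fun_of_small (f' := 0) (by
    intro τ s h3 h4 h1 h2
    have h5 := hHp s τ h1 h2 h3 h4
    rw [hc s τ h1 h3, ha' s τ h1 h3] at h5
    have e : ∀ g : ℤ × ℤ →₀ ℂ, ∑ k ∈ g.support, g k * τ ^ k.2 * s ^ k.1
        = ∑ k ∈ g.support, g k * s ^ k.1 * τ ^ k.2 := fun g =>
      Finset.sum_congr rfl fun k _ => by ring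
    simp [e, h5])).eq_zero hε
  have coeff : ∀ (g : ℤ × ℤ →₀ ℂ) (i j : ℤ),
      (∑ k ∈ g.support, -g k * (if i - k.1 = 0 ∧ j - k.2 = 0 then 1 else 0)) = -g (i, j) := by
    intro g i j
    have : ∀ k : ℤ × ℤ, (i - k.1 = 0 ∧ j - k.2 = 0) ↔ (i, j) = k := fun k => by
      rw [Prod.ext_iff, sub_eq_zero, sub_eq_zero]
    simp only [this, mul_ite, mul_one, mul_zero, Finset.sum_ite_eq]
    by_cases hm : (i, j) ∈ g.support
    · simp [hm]
    · simp [hm, Finsupp.notMem_support_iff.1 hm]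
  have haa : a = a' := by
    ext ⟨i, j⟩
    have h1 := z1 i j
    have h2 := z2 j i
    have h4 : (∑ k ∈ a'.support, -a' k * (if j - k.2 = 0 ∧ i - k.1 = 0 then 1 else 0))
        = -a' (i, j) := by
      rw [← coeff]
      exact Finset.sum_congr rfl fun k _ => by simp only [and_comm (a := j - k.2 = 0)]
    rw [Pi.add_apply, Pi.add_apply] at h1 h2
    rw [coeff] at h1
    rw [h4] at h2
    exact neg_injective (add_left_cancel (h1.trans h2.symm))
  rw [ha s τ hs hτ, ha' s τ hs hτ, haa]

/-! ## Grouping multi-index series by total degree -/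

lemma fiber_finite {n : ℕ} (N w ρ : ℤ) :
    {r : Fin n → ℤ | ∑ i, r i - w = ρ ∧ ∀ i, N ≤ r i}.Finite := by
  refine Set.Finite.subset (Set.Finite.pi' (t := fun _ : Fin n => Set.Icc N (ρ + w - n * N + N))
    fun _ => Set.finite_Icc _ _) ?_
  rintro r ⟨h1, h2⟩ i
  refine ⟨h2 i, ?_⟩
  have h3 : r i - N ≤ ∑ j, (r j - N) :=
    Finset.single_le_sum (f := fun j => r j - N) (fun j _ => by have := h2 j; linarith)
      (Finset.mem_univ i)
  rw [Finset.sum_sub_distrib] at h3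
  simp at h3
  linarith

/-- The multi-indices bounded below by `N` of shifted total degree `ρ`. -/
def degreeFiber (n : ℕ) (N w ρ : ℤ) : Finset (Fin n → ℤ) := (fiber_finite N w ρ).toFinset

lemma mem_degreeFiber {n : ℕ} {N w ρ : ℤ} {r : Fin n → ℤ} :
    r ∈ degreeFiber n N w ρ ↔ ∑ i, r i - w = ρ ∧ ∀ i, N ≤ r i := by
  simp [degreeFiber]

lemma degreeFiber_eq_empty {n : ℕ} {N w ρ : ℤ} (h : ρ < n * N - w) :
    degreeFiber n N w ρ = ∅ := by
  refine Finset.eq_empty_of_forall_notMem fun r hr => ?_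
  obtain ⟨h1, h2⟩ := mem_degreeFiber.1 hr
  have h3 : ∑ _i : Fin n, N ≤ ∑ i, r i := Finset.sum_le_sum fun i _ => h2 i
  simp at h3
  linarith

lemma hasSum_group_degree {n : ℕ} {N w : ℤ} {g : (Fin n → ℤ) → ℂ} {a τ : ℂ}
    (hg : ∀ r, (∃ i, r i < N) → g r = 0)
    (h : HasSum (fun r => τ ^ (∑ i, r i - w) * g r) a) :
    HasSum (fun ρ : ℤ => τ ^ ρ * ∑ r ∈ degreeFiber n N w ρ, g r) a := by
  refine hasSum_of_forall_eq (h.tsum_fiberwise fun r => ∑ i, r i - w) fun ρ => ?_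
  rw [tsum_subtype ((fun r : Fin n → ℤ => ∑ i, r i - w) ⁻¹' {ρ})
    (fun r => τ ^ (∑ i, r i - w) * g r), tsum_eq_sum (s := degreeFiber n N w ρ)]
  · rw [Finset.mul_sum]
    refine Finset.sum_congr rfl fun r hr => ?_
    have h1 := (mem_degreeFiber.1 hr).1
    rw [Set.indicator_of_mem (by exact h1), h1]
  · intro r hr
    by_cases h1 : ∑ i, r i - w = ρ
    · have : ∃ i, r i < N := by
        by_contra hcon
        push Not at hcon
        exact hr (mem_degreeFiber.2 ⟨h1, hcon⟩)
      simp [Set.indicator_apply, hg r this]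
    · exact Set.indicator_of_notMem (by exact h1) _

/-! ## Rational functions with poles on the diagonals -/

/-- The product of the `N`-th powers of the differences of the variables. -/
def diagPoly (T N : ℕ) : MvPolynomial (Fin T) ℂ :=
  ∏ i : Fin T, ∏ j : Fin T,
    if i < j then (MvPolynomial.X i - MvPolynomial.X j) ^ N else 1

lemma eval_diagPoly {T : ℕ} (N : ℕ) (z : Fin T → ℂ) : MvPolynomial.eval z (diagPoly T N)
    = ∏ i : Fin T, ∏ j : Fin T, (if i < j then (z i - z j) ^ N else 1) := by
  simp only [diagPoly, map_prod]
  refine Finset.prod_congr rfl fun i _ => Finset.prod_congr rfl fun j _ => ?_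
  split <;> simp

lemma eval_diagPoly_ne_zero {T : ℕ} (N : ℕ) {z : Fin T → ℂ} (hz : ∀ s t, s ≠ t → z s ≠ z t) :
    MvPolynomial.eval z (diagPoly T N) ≠ 0 := by
  rw [eval_diagPoly]
  refine Finset.prod_ne_zero_iff.2 fun i _ => Finset.prod_ne_zero_iff.2 fun j _ => ?_
  split
  · next h => exact pow_ne_zero _ (sub_ne_zero.2 (hz i j h.ne))
  · exact one_ne_zero

lemma eval_diagPoly_const_mul {T : ℕ} (N : ℕ) (τ : ℂ) (z : Fin T → ℂ) :
    MvPolynomial.eval (fun t => τ * z t) (diagPoly T N)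
      = (∏ i : Fin T, ∏ j : Fin T, if i < j then τ ^ N else 1)
        * MvPolynomial.eval z (diagPoly T N) := by
  simp only [eval_diagPoly, ← Finset.prod_mul_distrib]
  refine Finset.prod_congr rfl fun i _ => Finset.prod_congr rfl fun j _ => ?_
  split
  · rw [← mul_sub, mul_pow]
  · rw [one_mul]

lemma ratDiag_iff {T : ℕ} {f : (Fin T → ℂ) → ℂ} : RatDiag T f ↔
    ∃ (P : MvPolynomial (Fin T) ℂ) (N : ℕ), ∀ z : Fin T → ℂ, (∀ i j, i ≠ j → z i ≠ z j) →
      f z * MvPolynomial.eval z (diagPoly T N) = MvPolynomial.eval z P := by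
  simp only [eval_diagPoly, RatDiag]

/-- Points of decreasing nonzero moduli. -/
def RadiallyOrdered {T : ℕ} (z : Fin T → ℂ) : Prop :=
  (∀ s t, s < t → ‖z t‖ < ‖z s‖) ∧ ∀ t, z t ≠ 0

lemma RadiallyOrdered.ne {T : ℕ} {z : Fin T → ℂ} (h : RadiallyOrdered z) (s t : Fin T)
    (hst : s ≠ t) : z s ≠ z t := by
  intro heq
  rcases lt_or_gt_of_ne hst with h1 | h1
  · exact (h.1 s t h1).ne (by rw [heq])
  · exact (h.1 t s h1).ne (by rw [heq])

lemma RadiallyOrdered.chain {T : ℕ} {z : Fin T → ℂ} (h : RadiallyOrdered z) :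
    (List.finRange T).IsChain (fun s t => ‖z s‖ > ‖z t‖) :=
  ((List.pairwise_lt_finRange T).imp fun hst => h.1 _ _ hst).isChain

lemma RadiallyOrdered.mul_const {T : ℕ} {z : Fin T → ℂ} (h : RadiallyOrdered z) {τ : ℂ}
    (hτ : τ ≠ 0) : RadiallyOrdered (fun t => τ * z t) := by
  refine ⟨fun s t hst => ?_, fun t => mul_ne_zero hτ (h.2 t)⟩
  rw [norm_mul, norm_mul]
  exact mul_lt_mul_of_pos_left (h.1 s t hst) (norm_pos_iff.2 hτ)

lemma MvPolynomial.eq_of_eval_eq_on_radiallyOrdered {T : ℕ} {P Q : MvPolynomial (Fin T) ℂ}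
    (h : ∀ z : Fin T → ℂ, RadiallyOrdered z → MvPolynomial.eval z P = MvPolynomial.eval z Q) :
    P = Q := by
  refine MvPolynomial.funext_set
    (fun t : Fin T => (fun x : ℝ => (x : ℂ)) '' Set.Ioo ((T : ℝ) - t) (T - t + 1)) ?_ ?_
  · intro t
    exact (Set.Ioo_infinite (by linarith)).image Complex.ofReal_injective.injOn
  · intro z hz
    have hb : ∀ t : Fin T, (T : ℝ) - t < ‖z t‖ ∧ ‖z t‖ < T - t + 1 ∧ 0 < (T : ℝ) - t := by
      intro t
      obtain ⟨x, hx, hxz⟩ := hz t (Set.mem_univ t)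
      have ht : (t : ℝ) < T := by exact_mod_cast t.2
      have hx0 : 0 ≤ x := by linarith [hx.1]
      rw [← hxz]
      simp only [Complex.norm_real, Real.norm_of_nonneg hx0]
      exact ⟨hx.1, hx.2, by linarith⟩
    refine h z ⟨fun s t hst => ?_, fun t => ?_⟩
    · have h1 : (s : ℝ) + 1 ≤ t := by exact_mod_cast hst
      linarith [(hb t).2.1, (hb s).1]
    · exact norm_pos_iff.1 ((hb t).2.2.trans (hb t).1)

lemma RatDiag.eq_of_eq_on_radiallyOrdered {T : ℕ} {f g : (Fin T → ℂ) → ℂ} (hf : RatDiag T f)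
    (hg : RatDiag T g) (h : ∀ z, RadiallyOrdered z → f z = g z) {z : Fin T → ℂ}
    (hz : ∀ s t, s ≠ t → z s ≠ z t) : f z = g z := by
  obtain ⟨P, N, hP⟩ := ratDiag_iff.1 hf
  obtain ⟨Q, M, hQ⟩ := ratDiag_iff.1 hg
  have hPQ : P * diagPoly T M = Q * diagPoly T N := by
    refine MvPolynomial.eq_of_eval_eq_on_radiallyOrdered fun y hy => ?_
    rw [map_mul, map_mul, ← hP y hy.ne, ← hQ y hy.ne, h y hy]
    ring
  have h1 := congrArg (MvPolynomial.eval z) hPQ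
  rw [map_mul, map_mul, ← hP z hz, ← hQ z hz] at h1
  refine mul_right_cancel₀ (mul_ne_zero (eval_diagPoly_ne_zero N hz)
    (eval_diagPoly_ne_zero M hz)) ?_
  linear_combination h1

lemma RatDiag.const_mul {T : ℕ} {f : (Fin T → ℂ) → ℂ} (hf : RatDiag T f) (c : ℂ) :
    RatDiag T (fun z => c * f z) := by
  obtain ⟨P, N, hP⟩ := ratDiag_iff.1 hf
  refine ratDiag_iff.2 ⟨MvPolynomial.C c * P, N, fun z hz => ?_⟩
  rw [map_mul, MvPolynomial.eval_C, ← hP z hz, mul_assoc]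

lemma RatDiag.comp_const_mul {T : ℕ} {f : (Fin T → ℂ) → ℂ} (hf : RatDiag T f) {τ : ℂ}
    (hτ : τ ≠ 0) : RatDiag T (fun z => f (fun t => τ * z t)) := by
  obtain ⟨P, N, hP⟩ := ratDiag_iff.1 hf
  set K : ℂ := ∏ i : Fin T, ∏ j : Fin T, if i < j then τ ^ N else 1 with hK
  have hK0 : K ≠ 0 := by
    refine Finset.prod_ne_zero_iff.2 fun i _ => Finset.prod_ne_zero_iff.2 fun j _ => ?_
    split
    · exact pow_ne_zero _ hτ
    · exact one_ne_zero
  refine ratDiag_iff.2 ⟨MvPolynomial.C K⁻¹ *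
    MvPolynomial.bind₁ (fun t => MvPolynomial.C τ * MvPolynomial.X t) P, N, fun z hz => ?_⟩
  have h1 := hP (fun t => τ * z t) fun i j hij h => hz i j hij (mul_left_cancel₀ hτ h)
  rw [eval_diagPoly_const_mul, ← hK] at h1
  have h2 : MvPolynomial.eval z
      (MvPolynomial.bind₁ (fun t => MvPolynomial.C τ * MvPolynomial.X t) P)
      = MvPolynomial.eval (fun t => τ * z t) P := by
    clear h1 hP
    induction P using MvPolynomial.induction_on with
    | C a => simp
    | add p q hp hq => simp [hp, hq]
    | mul_X p i hp => simp [hp]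
  rw [map_mul, MvPolynomial.eval_C, h2, ← h1]
  field_simp

/-- Two rational functions whose restrictions to a Laurent polynomial surface are iterated sums
of the same double family, one in each order, agree on that surface. -/
lemma RatDiag.eq_of_iterSum {T : ℕ} {F G : (Fin T → ℂ) → ℂ} (hF : RatDiag T F)
    (hG : RatDiag T G) {z : ℂ → ℂ → Fin T → ℂ} (hz : ∀ t, IsLaurent fun s τ => z s τ t)
    {ε : ℝ} (hε : 0 < ε)
    (hdist : ∀ s τ : ℂ, s ≠ 0 → ‖s‖ < ε → τ ≠ 0 → ‖τ‖ < ε → ∀ i j, i ≠ j → z s τ i ≠ z s τ j)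
    {b : ℤ → ℤ → ℂ} (hFb : IterSum ε b fun s τ => F (z s τ))
    (hGb : IterSum ε (fun j i => b i j) fun τ s => G (z s τ))
    {s τ : ℂ} (hs : s ≠ 0) (hτ : τ ≠ 0) (hsτ : ∀ i j, i ≠ j → z s τ i ≠ z s τ j) :
    F (z s τ) = G (z s τ) := by
  obtain ⟨P, N, hP⟩ := ratDiag_iff.1 hF
  obtain ⟨Q, M, hQ⟩ := ratDiag_iff.1 hG
  have key := IterSum.laurent_eq (H := fun s τ => G (z s τ)) hε hFb hGb
    (IsLaurent.eval_mvPolynomial hz (diagPoly T N * diagPoly T M))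
    (IsLaurent.eval_mvPolynomial hz (P * diagPoly T M))
    (IsLaurent.eval_mvPolynomial hz (Q * diagPoly T N))
    (fun s τ h1 h2 h3 h4 => by
      simp only [map_mul]
      rw [← hP _ (hdist s τ h1 h2 h3 h4)]
      ring)
    (fun s τ h1 h2 h3 h4 => by
      simp only [map_mul]
      rw [← hQ _ (hdist s τ h1 h2 h3 h4)]
      ring) hs hτ
  simp only [map_mul] at key
  rw [← hP _ hsτ, ← hQ _ hsτ] at key
  refine mul_right_cancel₀ (mul_ne_zero (eval_diagPoly_ne_zero N hsτ)
    (eval_diagPoly_ne_zero M hsτ)) ?_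
  linear_combination key

section Grading

variable {ι X : Type*} [DecidableEq ι] [AddCommGroup X] [Module ℂ X]

/-- The projection of a graded space onto its `i`-th homogeneous component. -/
def gradedProj (g : ι → Submodule ℂ X) [DirectSum.Decomposition g] (i : ι) : X →ₗ[ℂ] X :=
  (g i).subtype ∘ₗ DirectSum.component ℂ ι (fun i => g i) i ∘ₗ
    (DirectSum.decomposeLinearEquiv g).toLinearMap

lemma gradedProj_of_mem (g : ι → Submodule ℂ X) [DirectSum.Decomposition g] {i : ι} {x : X}
    (hx : x ∈ g i) : gradedProj g i x = x :=
  DirectSum.decompose_of_mem_same g hx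

lemma gradedProj_of_mem_ne (g : ι → Submodule ℂ X) [DirectSum.Decomposition g] {i j : ι} {x : X}
    (hx : x ∈ g j) (hij : j ≠ i) : gradedProj g i x = 0 :=
  DirectSum.decompose_of_mem_ne g hx hij

lemma gradedProj_mem (g : ι → Submodule ℂ X) [DirectSum.Decomposition g] (i : ι) (x : X) :
    gradedProj g i x ∈ g i :=
  (DirectSum.decompose g x i).2

lemma sub_gradedProj_mem (g : ι → Submodule ℂ X) [DirectSum.Decomposition g] (i : ι) (x : X) :
    x - gradedProj g i x ∈ ⨆ j, ⨆ (_ : j ≠ i), g j := by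
  induction x using DirectSum.Decomposition.inductionOn g with
  | zero => simp
  | @homogeneous j m =>
    by_cases hj : j = i
    · subst hj
      rw [gradedProj_of_mem g m.2, sub_self]
      exact Submodule.zero_mem _
    · rw [gradedProj_of_mem_ne g m.2 hj, sub_zero]
      exact Submodule.mem_iSup_of_mem j (Submodule.mem_iSup_of_mem hj m.2)
  | add x y hx hy =>
    rw [map_add, add_sub_add_comm]
    exact Submodule.add_mem _ hx hy

lemma mem_of_mem_maxGenEigenspace (g : ι → Submodule ℂ X) [DirectSum.Decomposition g]
    {L : Module.End ℂ X} {e : ι → ℂ} (he : Function.Injective e)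
    (hg : ∀ i, g i ≤ L.maxGenEigenspace (e i)) {i : ι} {x : X}
    (hx : x ∈ L.maxGenEigenspace (e i)) : x ∈ g i := by
  have hind : iSupIndep fun i => L.maxGenEigenspace (e i) :=
    L.independent_maxGenEigenspace.comp he
  have h1 : x - gradedProj g i x ∈ L.maxGenEigenspace (e i) :=
    Submodule.sub_mem _ hx (hg i (gradedProj_mem g i x))
  have h2 : x - gradedProj g i x ∈ ⨆ j, ⨆ (_ : j ≠ i), L.maxGenEigenspace (e j) :=
    iSup₂_mono (fun j _ => hg j) (sub_gradedProj_mem g i x)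
  have h3 := Submodule.disjoint_def.1 (hind i) _ h1 h2
  rw [sub_eq_zero.1 h3]
  exact gradedProj_mem g i x

end Grading

namespace GRVA

variable (A : GRVA V)

/-- The projection of `V` onto `V_(k)`. -/
def proj (k : ℤ) : V →ₗ[ℂ] V :=
  letI := A.decomp
  gradedProj A.grading k

variable {A}

lemma proj_of_mem {k : ℤ} {v : V} (hv : v ∈ A.grading k) : A.proj k v = v :=
  letI := A.decomp
  gradedProj_of_mem A.grading hv

lemma proj_of_mem_ne {k j : ℤ} {v : V} (hv : v ∈ A.grading j) (h : j ≠ k) : A.proj k v = 0 :=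
  letI := A.decomp
  gradedProj_of_mem_ne A.grading hv h

lemma gradedFunctional_comp_proj (φ : V →ₗ[ℂ] ℂ) (k : ℤ) :
    GradedFunctionalZ A.grading (φ ∘ₗ A.proj k) := by
  refine (Set.finite_singleton k).subset ?_
  rintro j ⟨v, hv, h⟩
  by_contra hj
  exact h (by simp [proj_of_mem_ne hv hj])

lemma pairBarV_comp_proj (φ : V →ₗ[ℂ] ℂ) (k : ℤ) (ω : VbarT A) :
    pairBarV (φ ∘ₗ A.proj k) ω = φ (ω k : V) := by
  rw [pairBarV, finsum_eq_single _ k]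
  · simp [proj_of_mem (ω k).2]
  · intro j hj
    simp [proj_of_mem_ne (ω j).2 hj]

lemma grading_le_maxGenEigenspace (k : ℤ) : A.grading k ≤ A.L0.maxGenEigenspace (k : ℂ) := by
  intro v hv
  rw [Module.End.mem_maxGenEigenspace]
  exact ⟨1, by simp [A.L0_eq k v hv]⟩

lemma Y_mem {a b : ℤ} {u v : V} (hu : u ∈ A.grading a) (hv : v ∈ A.grading b) (k : ℤ) :
    A.Y u v k ∈ A.grading (a + b - k - 1) := by
  let := A.decomp
  refine mem_of_mem_maxGenEigenspace A.grading (L := A.L0) (e := fun k : ℤ => (k : ℂ))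
    Int.cast_injective grading_le_maxGenEigenspace ?_
  rw [Module.End.mem_maxGenEigenspace]
  refine ⟨1, ?_⟩
  rw [pow_one, LinearMap.sub_apply, A.L0_bracket, A.L0_eq a u hu, A.L0_eq b v hv]
  simp only [map_smul, LinearMap.smul_apply, Pi.smul_apply, Module.End.one_apply]
  push_cast
  module

lemma applyList_mem {n : ℕ} {v : Fin n → V} {wt : Fin n → ℤ} (hv : ∀ t, v t ∈ A.grading (wt t))
    (k : Fin n → ℤ) (L : List (Fin n)) :
    applyList A.Y v k L A.vacuum ∈ A.grading (L.map fun t => wt t - k t - 1).sum := by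
  induction L with
  | nil => exact A.vacuum_mem
  | cons t L ih =>
    have h := Y_mem (hv t) ih (k t)
    rw [List.map_cons, List.sum_cons, applyList]
    convert h using 2
    ring

lemma applyList_finRange_mem {n : ℕ} {v : Fin n → V} {wt : Fin n → ℤ}
    (hv : ∀ t, v t ∈ A.grading (wt t)) (k : Fin n → ℤ) :
    applyList A.Y v k (List.finRange n) A.vacuum ∈ A.grading (∑ t, wt t + ∑ t, (-k t - 1)) := by
  have h := applyList_mem hv k (List.finRange n)
  rw [← Fin.sum_univ_def] at h
  rw [← Finset.sum_add_distrib]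
  convert h using 3
  ring

end GRVA

namespace GRMod

variable {A : GRVA V} (M : GRMod V W A)

/-- The projection of `W` onto `W_(c)`. -/
def proj (c : ℂ) : W →ₗ[ℂ] W :=
  letI := M.decomp
  gradedProj M.grading c

variable {M}

lemma proj_of_mem {c : ℂ} {w : W} (hw : w ∈ M.grading c) : M.proj c w = w :=
  letI := M.decomp
  gradedProj_of_mem M.grading hw

lemma proj_of_mem_ne {c d : ℂ} {w : W} (hw : w ∈ M.grading d) (h : d ≠ c) : M.proj c w = 0 :=
  letI := M.decomp
  gradedProj_of_mem_ne M.grading hw h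

lemma gradedFunctional_comp_proj (φ : W →ₗ[ℂ] ℂ) (c : ℂ) :
    GradedFunctionalC M.grading (φ ∘ₗ M.proj c) := by
  refine (Set.finite_singleton c).subset ?_
  rintro d ⟨w, hw, h⟩
  by_contra hd
  exact h (by simp [proj_of_mem_ne hw hd])

lemma pairBar_comp_proj (φ : W →ₗ[ℂ] ℂ) (c : ℂ) (ω : WbarT M) :
    pairBar (φ ∘ₗ M.proj c) ω = φ (ω c : W) := by
  rw [pairBar, finsum_eq_single _ c]
  · simp [proj_of_mem (ω c).2]
  · intro d hd
    simp [proj_of_mem_ne (ω d).2 hd]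

lemma grading_le_maxGenEigenspace (c : ℂ) : M.grading c ≤ M.L0.maxGenEigenspace c := by
  intro w hw
  rw [Module.End.mem_maxGenEigenspace]
  exact M.L0_nilpotent c w hw

lemma L0_sub_pow_Y {a : ℤ} {u : V} (hu : u ∈ A.grading a) (c : ℂ) (k : ℤ) (K : ℕ) (w : W) :
    ((M.L0 - (c + (a - k - 1 : ℤ)) • (1 : Module.End ℂ W)) ^ K) (M.Y u w k)
      = M.Y u (((M.L0 - c • (1 : Module.End ℂ W)) ^ K) w) k := by
  induction K generalizing w with
  | zero => simp
  | succ K ih =>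
    rw [pow_succ, pow_succ, Module.End.mul_apply, Module.End.mul_apply, ← ih]
    congr 1
    rw [LinearMap.sub_apply, M.L0_bracket, A.L0_eq a u hu]
    simp only [map_smul, LinearMap.smul_apply, Pi.smul_apply, Module.End.one_apply,
      LinearMap.sub_apply, map_sub, Pi.sub_apply]
    push_cast
    module

lemma Y_mem {a : ℤ} {c : ℂ} {u : V} {w : W} (hu : u ∈ A.grading a) (hw : w ∈ M.grading c)
    (k : ℤ) : M.Y u w k ∈ M.grading (c + (a - k - 1 : ℤ)) := by
  let := M.decomp
  refine mem_of_mem_maxGenEigenspace M.grading (L := M.L0) (e := fun c : ℂ => c)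
    (fun _ _ h => h) grading_le_maxGenEigenspace ?_
  rw [Module.End.mem_maxGenEigenspace]
  obtain ⟨K, hK⟩ := M.L0_nilpotent c w hw
  exact ⟨K, by rw [L0_sub_pow_Y hu, hK]; simp⟩

lemma applyList_mem {n : ℕ} {v : Fin n → V} {wt : Fin n → ℤ} (hv : ∀ t, v t ∈ A.grading (wt t))
    (k : Fin n → ℤ) {c : ℂ} {w : W} (hw : w ∈ M.grading c) (L : List (Fin n)) :
    applyList M.Y v k L w ∈ M.grading (c + ((L.map fun t => wt t - k t - 1).sum : ℤ)) := by
  induction L with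
  | nil => simpa [applyList] using hw
  | cons t L ih =>
    have h := Y_mem (hv t) ih (k t)
    rw [List.map_cons, List.sum_cons, applyList]
    convert h using 2
    push_cast
    ring

lemma applyList_finRange_mem {n : ℕ} {v : Fin n → V} {wt : Fin n → ℤ}
    (hv : ∀ t, v t ∈ A.grading (wt t)) (k : Fin n → ℤ) {c : ℂ} {w : W} (hw : w ∈ M.grading c) :
    applyList M.Y v k (List.finRange n) w
      ∈ M.grading (c + ((∑ t, wt t + ∑ t, (-k t - 1) : ℤ) : ℂ)) := by
  have h := applyList_mem hv k hw (List.finRange n)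
  rw [← Fin.sum_univ_def] at h
  rw [← Finset.sum_add_distrib]
  convert h using 5
  ring

end GRMod

lemma applyList_add {X : Type} [AddCommGroup X] [Module ℂ X] {n : ℕ}
    (Yop : V →ₗ[ℂ] X →ₗ[ℂ] (ℤ → X)) (v : Fin n → V) (k : Fin n → ℤ) (L : List (Fin n)) (x y : X) :
    applyList Yop v k L (x + y) = applyList Yop v k L x + applyList Yop v k L y := by
  induction L with
  | nil => rfl
  | cons t L ih => simp [applyList, ih]

lemma applyList_smul {X : Type} [AddCommGroup X] [Module ℂ X] {n : ℕ}
    (Yop : V →ₗ[ℂ] X →ₗ[ℂ] (ℤ → X)) (v : Fin n → V) (k : Fin n → ℤ) (L : List (Fin n)) (a : ℂ)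
    (x : X) : applyList Yop v k L (a • x) = a • applyList Yop v k L x := by
  induction L with
  | nil => rfl
  | cons t L ih => simp [applyList, ih]

lemma prod_const_mul_zpow {T : ℕ} {τ : ℂ} (hτ : τ ≠ 0) (z : Fin T → ℂ) (k : Fin T → ℤ) :
    ∏ t, (τ * z t) ^ k t = τ ^ (∑ t, k t) * ∏ t, z t ^ k t := by
  have h (S : Finset (Fin T)) : ∏ t ∈ S, (τ * z t) ^ k t
      = τ ^ (∑ t ∈ S, k t) * ∏ t ∈ S, z t ^ k t := by
    induction S using Finset.induction_on with
    | empty => simp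
    | insert a S ha ih =>
      rw [Finset.prod_insert ha, Finset.sum_insert ha, Finset.prod_insert ha, ih, zpow_add₀ hτ,
        mul_zpow]
      ring
  exact h Finset.univ

lemma eq_of_forall_dual_apply_eq {X : Type*} [AddCommGroup X] [Module ℂ X] {x y : X}
    (h : ∀ φ : X →ₗ[ℂ] ℂ, φ x = φ y) : x = y := by
  rw [← sub_eq_zero, ← Module.forall_dual_apply_eq_zero_iff ℂ]
  intro φ
  rw [map_sub, h φ, sub_self]

lemma RatDiag.const (T : ℕ) (c : ℂ) : RatDiag T fun _ => c :=
  ⟨MvPolynomial.C c, 0, fun z _ => by simp⟩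

namespace IsEVFam

variable {A : GRVA V} {EV : ∀ l : ℕ, (Fin l → V) → (Fin l → ℂ) → VbarT A}

lemma apply_const_mul (hEV : IsEVFam A EV) {l : ℕ} {v : Fin l → V} {wt : Fin l → ℤ}
    (hv : ∀ t, v t ∈ A.grading (wt t)) {τ : ℂ} (hτ : τ ≠ 0) {z : Fin l → ℂ}
    (hz : ∀ s t, s ≠ t → z s ≠ z t) (r : ℤ) :
    (EV l v (fun t => τ * z t) r : V) = τ ^ (r - ∑ t, wt t) • (EV l v z r : V) := by
  refine eq_of_forall_dual_apply_eq fun φ => ?_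
  obtain ⟨f, hf, hsum, hval⟩ := hEV l v _ (GRVA.gradedFunctional_comp_proj φ r)
  have hz' : ∀ s t, s ≠ t → τ * z s ≠ τ * z t := fun s t hst h => hz s t hst (mul_left_cancel₀ hτ h)
  rw [map_smul, smul_eq_mul, ← GRVA.pairBarV_comp_proj φ r, ← GRVA.pairBarV_comp_proj φ r,
    hval z hz, hval _ hz']
  refine RatDiag.eq_of_eq_on_radiallyOrdered (hf.comp_const_mul hτ)
    (hf.const_mul (τ ^ (r - ∑ t, wt t))) (fun x hx => ?_) hz
  have h1 := hsum _ (hx.mul_const hτ).chain (hx.mul_const hτ).2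
  have h2 := (hsum _ hx.chain hx.2).mul_left (τ ^ (r - ∑ t, wt t))
  refine h1.unique (hasSum_of_forall_eq h2 fun k => ?_)
  have hk := GRVA.applyList_finRange_mem hv k
  rw [prod_const_mul_zpow hτ]
  by_cases hr : ∑ t, wt t + ∑ t, (-k t - 1) = r
  · rw [← hr, add_sub_cancel_left]
    ring
  · rw [LinearMap.comp_apply, GRVA.proj_of_mem_ne hk hr, map_zero]
    ring

lemma apply_one_zero (hEV : IsEVFam A EV) {l : ℕ} (hl : l = 1) {v : Fin l → V} {u : V}
    (hv : ∀ t, v t = u) {a : ℤ} (hu : u ∈ A.grading a) {z : Fin l → ℂ} (hz : ∀ t, z t = 0)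
    (r : ℤ) : (EV l v z r : V) = if r = a then u else 0 := by
  subst hl
  have hd (x : Fin 1 → ℂ) (s t : Fin 1) (hst : s ≠ t) : x s ≠ x t :=
    absurd (Subsingleton.elim s t) hst
  have hv' (t : Fin 1) : v t ∈ A.grading a := by rw [hv t]; exact hu
  split_ifs with hr
  · subst hr
    refine eq_of_forall_dual_apply_eq fun φ => ?_
    obtain ⟨f, hf, hsum, hval⟩ := hEV 1 v _ (GRVA.gradedFunctional_comp_proj φ r)
    rw [← GRVA.pairBarV_comp_proj φ r, hval z (hd z)]
    refine RatDiag.eq_of_eq_on_radiallyOrdered hf (RatDiag.const 1 (φ u)) (fun x hx => ?_) (hd z)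
    have h1 := hsum x hx.chain hx.2
    have h2 := hasSum_single (f := fun k : Fin 1 → ℤ =>
      (φ ∘ₗ A.proj r) (applyList A.Y v k (List.finRange 1) A.vacuum) * ∏ t, x t ^ (-(k t) - 1))
      (fun _ => -1) (fun k hk => by
        have hmem := GRVA.applyList_finRange_mem hv' k
        rw [LinearMap.comp_apply, GRVA.proj_of_mem_ne hmem, map_zero, zero_mul]
        intro h
        refine hk (funext fun t => ?_)
        rw [Subsingleton.elim t 0]
        simp at h
        linarith)
    rw [h1.unique h2]
    simp [List.finRange_succ, applyList, hv, A.creation_lim, GRVA.proj_of_mem hu]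
  · have h := hEV.apply_const_mul hv' (τ := 2) two_ne_zero (hd z) r
    have hz2 : (fun t => 2 * z t) = z := by
      funext t
      simp [hz]
    rw [hz2] at h
    have h2 : ((2 : ℂ) ^ (r - ∑ _t : Fin 1, a) - 1) • (EV 1 v z r : V) = 0 := by
      rw [sub_smul, ← h, one_smul, sub_self]
    refine (smul_eq_zero.1 h2).resolve_left fun h3 => hr ?_
    have h4 := congrArg norm (sub_eq_zero.1 h3)
    rw [norm_zpow, norm_one, Complex.norm_two, zpow_eq_one_iff_right₀ (by norm_num)
      (by norm_num)] at h4
    simpa [sub_eq_zero] using h4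

end IsEVFam

lemma GRVA.coe_eq_zero_of_lt {A : GRVA V} {N : ℤ} (hN : ∀ k < N, A.grading k = ⊥) {k : ℤ}
    (hk : k < N) (x : A.grading k) : (x : V) = 0 := by
  have h := (hN k hk).le x.2
  rwa [Submodule.mem_bot] at h

namespace IsEWFam

variable {A : GRVA V} {M : GRMod V W A} {EW : ∀ m : ℕ, (Fin m → V) → W → (Fin m → ℂ) → WbarT M}

lemma hasSum_pairBar (hEW : IsEWFam M EW) {q : ℕ} (v : Fin q → V) {x : Fin q → ℂ}
    (hx : RadiallyOrdered x) {w' : W →ₗ[ℂ] ℂ} (hw' : GradedFunctionalC M.grading w') (u : W) :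
    HasSum (fun k : Fin q → ℤ =>
      w' (applyList M.Y v k (List.finRange q) u) * ∏ t, x t ^ (-(k t) - 1))
      (pairBar w' (EW q v u x)) := by
  obtain ⟨f, -, hsum, hval⟩ := hEW q v u w' hw'
  rw [hval x hx.ne hx.2]
  exact hsum x hx.chain hx.2

lemma exists_linearMap (hEW : IsEWFam M EW) {q : ℕ} (v : Fin q → V) {x : Fin q → ℂ}
    (hx : RadiallyOrdered x) {w' : W →ₗ[ℂ] ℂ} (hw' : GradedFunctionalC M.grading w') :
    ∃ E : W →ₗ[ℂ] ℂ, ∀ u, E u = pairBar w' (EW q v u x) := by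
  refine ⟨{ toFun := fun u => pairBar w' (EW q v u x)
            map_add' := fun u₁ u₂ => ?_
            map_smul' := fun a u => ?_ }, fun u => rfl⟩
  · refine (hEW.hasSum_pairBar v hx hw' _).unique (hasSum_of_forall_eq
      ((hEW.hasSum_pairBar v hx hw' u₁).add (hEW.hasSum_pairBar v hx hw' u₂)) fun k => ?_)
    rw [applyList_add, map_add, add_mul]
  · refine (hEW.hasSum_pairBar v hx hw' _).unique (hasSum_of_forall_eq
      ((hEW.hasSum_pairBar v hx hw' u).mul_left a) fun k => ?_)
    rw [applyList_smul, map_smul, smul_eq_mul, mul_assoc]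

lemma pairBar_const_mul (hEW : IsEWFam M EW) {q : ℕ} {v : Fin q → V} {wt : Fin q → ℤ}
    (hv : ∀ t, v t ∈ A.grading (wt t)) {x : Fin q → ℂ} (hx : RadiallyOrdered x) (φ : W →ₗ[ℂ] ℂ)
    {c d : ℂ} {κ : ℤ} (hc : c = d - (∑ t, wt t : ℤ) + κ) {u : W} (hu : u ∈ M.grading c) {s : ℂ}
    (hs : s ≠ 0) : pairBar (φ ∘ₗ M.proj d) (EW q v u fun t => s⁻¹ * x t)
      = s ^ κ * pairBar (φ ∘ₗ M.proj d) (EW q v u x) := by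
  have hφ := GRMod.gradedFunctional_comp_proj (M := M) φ d
  refine (hEW.hasSum_pairBar v (hx.mul_const (inv_ne_zero hs)) hφ u).unique
    (hasSum_of_forall_eq ((hEW.hasSum_pairBar v hx hφ u).mul_left (s ^ κ)) fun k => ?_)
  rw [prod_const_mul_zpow (inv_ne_zero hs)]
  have hk := GRMod.applyList_finRange_mem hv k hu
  by_cases hd : c + ((∑ t, wt t + ∑ t, (-k t - 1) : ℤ) : ℂ) = d
  · have h : ∑ t, (-k t - 1) = -κ := by
      have h2 : ((∑ t, (-k t - 1) : ℤ) : ℂ) = ((-κ : ℤ) : ℂ) := by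
        rw [hc, Int.cast_add] at hd
        rw [Int.cast_neg]
        linear_combination hd
      exact_mod_cast h2
    rw [h, inv_zpow', neg_neg]
    ring
  · rw [LinearMap.comp_apply, GRMod.proj_of_mem_ne hk hd, map_zero]
    ring

lemma pairBar_eq_zero (hEW : IsEWFam M EW) {q : ℕ} {v : Fin q → V} {wt : Fin q → ℤ}
    (hv : ∀ t, v t ∈ A.grading (wt t)) {x : Fin q → ℂ} (hx : RadiallyOrdered x) (φ : W →ₗ[ℂ] ℂ)
    {c d : ℂ} (hc : ∀ κ : ℤ, c ≠ d - (∑ t, wt t : ℤ) + κ) {u : W} (hu : u ∈ M.grading c) :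
    pairBar (φ ∘ₗ M.proj d) (EW q v u x) = 0 := by
  refine (hEW.hasSum_pairBar v hx (GRMod.gradedFunctional_comp_proj φ d) u).unique
    (hasSum_of_forall_eq hasSum_zero fun k => ?_)
  have hk := GRMod.applyList_finRange_mem hv k hu
  rw [LinearMap.comp_apply, GRMod.proj_of_mem_ne hk, map_zero, zero_mul]
  intro h
  refine hc (-∑ t, (-k t - 1)) ?_
  rw [← h]
  push_cast
  ring

lemma hasSum_int (hEW : IsEWFam M EW) {q : ℕ} {v : Fin q → V} {wt : Fin q → ℤ}
    (hv : ∀ t, v t ∈ A.grading (wt t)) {x : Fin q → ℂ} (hx : RadiallyOrdered x) (φ : W →ₗ[ℂ] ℂ)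
    {d : ℂ} {ω : WbarT M} {s : ℂ} (hs : s ≠ 0) {a : ℂ}
    (h : HasSum (fun c : ℂ => pairBar (φ ∘ₗ M.proj d) (EW q v (ω c) fun t => s⁻¹ * x t)) a) :
    HasSum (fun κ : ℤ => s ^ κ *
      pairBar (φ ∘ₗ M.proj d) (EW q v (ω (d - (∑ t, wt t : ℤ) + κ)) x)) a := by
  have hinj : Function.Injective fun κ : ℤ => d - (∑ t, wt t : ℤ) + (κ : ℂ) := fun κ κ' hκ => by
    simpa using hκ
  refine hasSum_of_forall_eq ((hinj.hasSum_iff fun c hc => ?_).2 h) fun κ => ?_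
  · exact hEW.pairBar_eq_zero hv (hx.mul_const (inv_ne_zero hs)) φ
      (fun κ hκ => hc ⟨κ, hκ.symm⟩) (ω c).2
  · exact (hEW.pairBar_const_mul hv hx φ rfl (ω _).2 hs).symm

end IsEWFam

lemma GRMod.exists_coe_eq_zero {A : GRVA V} (M : GRMod V W A) (d : ℂ) :
    ∃ N : ℤ, ∀ κ < N, ∀ ω : WbarT M, (ω (d + κ) : W) = 0 := by
  obtain ⟨N, hN⟩ := M.lower_trunc
  refine ⟨⌊N - d.re⌋, fun κ hκ ω => ?_⟩
  have h := (hN (d + κ) ?_).le (ω (d + κ)).2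
  · rwa [Submodule.mem_bot] at h
  · have h2 : (κ : ℝ) < ⌊N - d.re⌋ := by exact_mod_cast hκ
    have h3 := Int.floor_le (N - d.re)
    simp
    linarith

section Blocks

lemma blockStart_add_le {n : ℕ} (l : Fin n → ℕ) {i j : Fin n} (hij : i < j) :
    blockStart l i + l i ≤ blockStart l j := by
  have hi : i ∉ Finset.univ.filter (fun k => k < i) := by simp
  have h : blockStart l i + l i = ∑ k ∈ insert i (Finset.univ.filter (fun k => k < i)), l k := by
    rw [Finset.sum_insert hi, Nat.add_comm]
    rfl
  rw [h]
  refine Finset.sum_le_sum_of_subset fun k hk => ?_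
  rw [Finset.mem_insert, Finset.mem_filter] at hk
  rw [Finset.mem_filter]
  refine ⟨Finset.mem_univ k, ?_⟩
  rcases hk with rfl | hk
  · exact hij
  · exact hk.2.trans hij

variable {n m : ℕ} {l : Fin n → ℕ} (hsum : ∑ i, l i = m)

lemma blockEmb_lt_blockEmb {i j : Fin n} (hij : i < j) (p : Fin (l i)) (p' : Fin (l j)) :
    blockEmb l hsum i p < blockEmb l hsum j p' := by
  have h := blockStart_add_le l hij
  have hp := p.2
  simp only [blockEmb, Fin.lt_def]
  omega

lemma blockEmb_bijective :
    Function.Bijective fun x : (i : Fin n) × Fin (l i) => blockEmb l hsum x.1 x.2 := by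
  rw [Fintype.bijective_iff_injective_and_card]
  refine ⟨?_, by simp [hsum]⟩
  rintro ⟨i, p⟩ ⟨j, p'⟩ h
  obtain hij | rfl | hij := lt_trichotomy i j
  · exact absurd h (blockEmb_lt_blockEmb hsum hij p p').ne
  · simp only [blockEmb, Fin.mk.injEq] at h
    congr 1
    exact Fin.ext (by omega)
  · exact absurd h (blockEmb_lt_blockEmb hsum hij p' p).ne'

lemma sum_blockEmb (f : Fin m → ℤ) : ∑ i, ∑ p, f (blockEmb l hsum i p) = ∑ t, f t := by
  rw [← Fintype.sum_sigma']
  exact (blockEmb_bijective hsum).sum_comp f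

lemma exists_blockIndex : ∃ β : Fin m → Fin n, ∀ i p, β (blockEmb l hsum i p) = i := by
  choose g hg using (blockEmb_bijective hsum).2
  refine ⟨fun t => (g t).1, fun i p => ?_⟩
  exact congrArg Sigma.fst ((blockEmb_bijective hsum).1 (hg (blockEmb l hsum i p)) : _ = ⟨i, p⟩)

variable {q : ℕ} (hsum' : ∑ i : Fin (q + n), (Fin.append (fun _ : Fin q => 1) l) i = q + m)

lemma blockStart_append_castAdd (i : Fin q) :
    blockStart (Fin.append (fun _ : Fin q => 1) l) (Fin.castAdd n i) = i := by
  rw [blockStart, Finset.sum_filter, Fin.sum_univ_add]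
  have h (j : Fin n) : ¬ Fin.natAdd q j < Fin.castAdd n i := by
    simp only [Fin.lt_def, Fin.val_natAdd, Fin.val_castAdd]
    omega
  simp only [h, if_false, Finset.sum_const_zero, add_zero, Fin.append_left]
  rw [← Finset.sum_filter, Finset.sum_const, smul_eq_mul, mul_one]
  have h2 : (Finset.univ.filter fun j : Fin q => Fin.castAdd n j < Fin.castAdd n i)
      = Finset.Iio i := by
    ext j
    rw [Finset.mem_filter, Finset.mem_Iio, Fin.lt_def, Fin.lt_def, Fin.val_castAdd,
      Fin.val_castAdd]
    exact ⟨fun hj => hj.2, fun hj => ⟨Finset.mem_univ j, hj⟩⟩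
  rw [h2, Fin.card_Iio]

lemma blockStart_append_natAdd (j : Fin n) :
    blockStart (Fin.append (fun _ : Fin q => 1) l) (Fin.natAdd q j) = q + blockStart l j := by
  rw [blockStart, Finset.sum_filter, Fin.sum_univ_add, blockStart, Finset.sum_filter]
  have h (i : Fin q) : Fin.castAdd n i < Fin.natAdd q j := by
    simp only [Fin.lt_def, Fin.val_natAdd, Fin.val_castAdd]
    omega
  have h2 (k : Fin n) : Fin.natAdd q k < Fin.natAdd q j ↔ k < j := by
    simp only [Fin.lt_def, Fin.val_natAdd]
    omega
  simp [h, h2]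

lemma blockEmb_append_castAdd (i : Fin q)
    (p : Fin (Fin.append (fun _ : Fin q => 1) l (Fin.castAdd n i))) :
    blockEmb _ hsum' (Fin.castAdd n i) p = Fin.castAdd m i := by
  have hp := p.2.trans_eq (Fin.append_left (fun _ : Fin q => 1) l i)
  refine Fin.ext ?_
  simp only [blockEmb, blockStart_append_castAdd, Fin.val_castAdd]
  omega

lemma blockEmb_append_natAdd (j : Fin n)
    (p : Fin (Fin.append (fun _ : Fin q => 1) l (Fin.natAdd q j))) :
    blockEmb _ hsum' (Fin.natAdd q j) p
      = Fin.natAdd q (blockEmb l hsum j (Fin.cast (Fin.append_right _ l j) p)) := by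
  refine Fin.ext ?_
  simp only [blockEmb, blockStart_append_natAdd, Fin.val_natAdd, Fin.val_cast]
  omega

end Blocks

lemma EV_congr {A : GRVA V} (EV : ∀ l : ℕ, (Fin l → V) → (Fin l → ℂ) → VbarT A) {k l : ℕ}
    (h : k = l) {v : Fin k → V} {v' : Fin l → V} (hv : ∀ p, v p = v' (Fin.cast h p))
    {z : Fin k → ℂ} {z' : Fin l → ℂ} (hz : ∀ p, z p = z' (Fin.cast h p)) :
    EV k v z = EV l v' z' := by
  subst h
  rw [show v = v' from funext hv, show z = z' from funext hz]

section Curve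

/-- The centres of the discs into which the blocks of points are contracted. -/
def node (n : ℕ) (j : Fin n) : ℂ := ((j + 1 : ℕ) : ℂ)

lemma norm_node {n : ℕ} (j : Fin n) : ‖node n j‖ = j + 1 := by
  rw [node, Complex.norm_natCast]
  push_cast
  rfl

lemma one_le_norm_node {n : ℕ} (j : Fin n) : 1 ≤ ‖node n j‖ := by
  rw [norm_node]
  linarith [(Nat.cast_nonneg (j : ℕ) : (0 : ℝ) ≤ ((j : ℕ) : ℝ))]

lemma norm_node_le {n : ℕ} (j : Fin n) : ‖node n j‖ ≤ n := by
  rw [norm_node]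
  exact_mod_cast j.2

lemma one_le_norm_node_sub {n : ℕ} {i j : Fin n} (hij : i ≠ j) : 1 ≤ ‖node n i - node n j‖ := by
  have h : node n i - node n j = (((i : ℕ) : ℤ) - ((j : ℕ) : ℤ) : ℤ) := by
    simp [node]
  rw [h, Complex.norm_intCast]
  have h2 : ((i : ℕ) : ℤ) - ((j : ℕ) : ℤ) ≠ 0 := by
    rw [sub_ne_zero]
    exact_mod_cast fun h => hij (Fin.ext h)
  exact_mod_cast Int.one_le_abs h2

lemma node_injective (n : ℕ) : Function.Injective (node n) := fun i j h => by
  by_contra hij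
  have h2 := one_le_norm_node_sub hij
  rw [h, sub_self, norm_zero] at h2
  linarith

/-- The points `y t` contracted by the factor `τ` towards the centres of their blocks. -/
def contracted {n m : ℕ} (β : Fin m → Fin n) (y : Fin m → ℂ) (τ : ℂ) (t : Fin m) : ℂ :=
  node n (β t) + τ * (y t - node n (β t))

lemma exists_small {T : ℕ} (c : Fin T → ℂ) :
    ∃ ε : ℝ, 0 < ε ∧ ∀ τ : ℂ, ‖τ‖ < ε → ∀ t, ‖τ * c t‖ < 1 / 2 := by
  have hS : 0 ≤ ∑ t, ‖c t‖ := Finset.sum_nonneg fun t _ => norm_nonneg (c t)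
  have hε : 0 < 1 / (2 * (1 + ∑ t, ‖c t‖)) := by positivity
  refine ⟨_, hε, fun τ hτ t => ?_⟩
  have h1 : ‖c t‖ ≤ ∑ t, ‖c t‖ :=
    Finset.single_le_sum (f := fun t => ‖c t‖) (fun t _ => norm_nonneg (c t)) (Finset.mem_univ t)
  rw [norm_mul]
  calc ‖τ‖ * ‖c t‖ ≤ ‖τ‖ * (1 + ∑ t, ‖c t‖) := by gcongr; linarith
    _ < 1 / (2 * (1 + ∑ t, ‖c t‖)) * (1 + ∑ t, ‖c t‖) := by gcongr
    _ = 1 / 2 := by field_simp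

lemma exists_large {T : ℕ} {x : Fin T → ℂ} (hx : ∀ t, x t ≠ 0) {R : ℝ} (hR : 0 < R) :
    ∃ ε : ℝ, 0 < ε ∧ ∀ s : ℂ, s ≠ 0 → ‖s‖ < ε → ∀ t, R < ‖s⁻¹ * x t‖ := by
  obtain ⟨ε, hε, h⟩ := exists_small fun t => (R : ℂ) / x t
  refine ⟨ε, hε, fun s hs hsε t => ?_⟩
  have h1 := h s hsε t
  have hs' := norm_pos_iff.2 hs
  have hx' := norm_pos_iff.2 (hx t)
  rw [norm_mul, norm_div, Complex.norm_real, Real.norm_of_nonneg hR.le, mul_div_assoc',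
    div_lt_iff₀ hx'] at h1
  rw [norm_mul, norm_inv, ← div_eq_inv_mul, lt_div_iff₀ hs']
  linarith

variable {n m q : ℕ} {β : Fin m → Fin n} {y : Fin m → ℂ} {τ : ℂ}

lemma norm_contracted_sub_node (h : ∀ t, ‖τ * (y t - node n (β t))‖ < 1 / 2) (t : Fin m) :
    ‖contracted β y τ t - node n (β t)‖ < 1 / 2 := by
  rw [contracted, add_sub_cancel_left]
  exact h t

lemma contracted_ne (h : ∀ t, ‖τ * (y t - node n (β t))‖ < 1 / 2) (hτ : τ ≠ 0)
    (hy : ∀ s t, s ≠ t → y s ≠ y t) (s t : Fin m) (hst : s ≠ t) :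
    contracted β y τ s ≠ contracted β y τ t := by
  intro he
  by_cases hβ : β s = β t
  · rw [contracted, contracted, hβ] at he
    exact hy s t hst (by simpa [hτ] using he)
  · have h1 := norm_contracted_sub_node h s
    have h2 := norm_contracted_sub_node h t
    have h3 := one_le_norm_node_sub hβ
    have h4 := norm_sub_le (contracted β y τ t - node n (β t))
      (contracted β y τ s - node n (β s))
    rw [he, sub_sub_sub_cancel_left] at h4
    rw [he] at h1
    linarith

lemma norm_contracted_lt (h : ∀ t, ‖τ * (y t - node n (β t))‖ < 1 / 2) (t : Fin m) :
    ‖contracted β y τ t‖ < n + 1 := by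
  have h1 := norm_contracted_sub_node h t
  have h2 := norm_node_le (β t)
  have h3 := norm_add_le (contracted β y τ t - node n (β t)) (node n (β t))
  rw [sub_add_cancel] at h3
  linarith

lemma contracted_ne_zero (h : ∀ t, ‖τ * (y t - node n (β t))‖ < 1 / 2) (t : Fin m) :
    contracted β y τ t ≠ 0 := by
  intro h0
  have h1 := norm_contracted_sub_node h t
  have h2 := one_le_norm_node (β t)
  rw [h0, zero_sub, norm_neg] at h1
  linarith

lemma append_ne {a b : ℕ} {x : Fin a → ℂ} {y : Fin b → ℂ} (hx : ∀ s t, s ≠ t → x s ≠ x t)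
    (hy : ∀ s t, s ≠ t → y s ≠ y t) (hxy : ∀ s t, ‖y t‖ < ‖x s‖) (s t : Fin (a + b))
    (hst : s ≠ t) : Fin.append x y s ≠ Fin.append x y t := by
  induction s using Fin.addCases with
  | left s =>
    induction t using Fin.addCases with
    | left t =>
      simp only [Fin.append_left]
      exact hx s t fun h => hst (by rw [h])
    | right t =>
      simp only [Fin.append_left, Fin.append_right]
      intro h
      have h2 := hxy s t
      rw [h] at h2
      exact lt_irrefl _ h2
  | right s =>
    induction t using Fin.addCases with
    | left t =>
      simp only [Fin.append_left, Fin.append_right]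
      intro h
      have h2 := hxy t s
      rw [h] at h2
      exact lt_irrefl _ h2
    | right t =>
      simp only [Fin.append_right]
      exact hy s t fun h => hst (by rw [h])

end Curve

section Composition

variable {A : GRVA V} {M : GRMod V W A}
  {EV : ∀ l : ℕ, (Fin l → V) → (Fin l → ℂ) → VbarT A}
  {EW : ∀ m : ℕ, (Fin m → V) → W → (Fin m → ℂ) → WbarT M} {n m : ℕ}

/-- The homogeneous components of the products of vertex operators over the blocks of points,
with the points of the `i`-th block taken relative to `ζ i`. -/
def blockComponent (EV : ∀ l : ℕ, (Fin l → V) → (Fin l → ℂ) → VbarT A) (l : Fin n → ℕ)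
    (hsum : ∑ i, l i = m) (v : Fin m → V) (z : Fin m → ℂ) (ζ : Fin n → ℂ) (r : Fin n → ℤ)
    (i : Fin n) : V :=
  EV (l i) (fun p => v (blockEmb l hsum i p)) (fun p => z (blockEmb l hsum i p) - ζ i) (r i)

variable {l : Fin n → ℕ} {hsum : ∑ i, l i = m} {v : Fin m → V} {wt : Fin m → ℤ}
  {β : Fin m → Fin n} {y : Fin m → ℂ} {τ : ℂ}

lemma blockComponent_contracted (hEV : IsEVFam A EV) (hv : ∀ t, v t ∈ A.grading (wt t))
    (hβ : ∀ i p, β (blockEmb l hsum i p) = i) (hy : ∀ s t, s ≠ t → y s ≠ y t) (hτ : τ ≠ 0)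
    (r : Fin n → ℤ) (i : Fin n) :
    blockComponent EV l hsum v (contracted β y τ) (node n) r i
      = τ ^ (r i - ∑ p, wt (blockEmb l hsum i p)) • blockComponent EV l hsum v y (node n) r i := by
  have h := hEV.apply_const_mul (v := fun p => v (blockEmb l hsum i p))
    (wt := fun p => wt (blockEmb l hsum i p)) (fun p => hv _) hτ
    (z := fun p => y (blockEmb l hsum i p) - node n i)
    (fun s t hst he => hy _ _ (fun h => hst
      (by simpa using (blockEmb_bijective hsum).1 (a₁ := ⟨i, s⟩) (a₂ := ⟨i, t⟩) h))
      (sub_left_injective he)) (r i)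
  rw [blockComponent, blockComponent, ← h]
  simp only [contracted, hβ, add_sub_cancel_left]

lemma prod_zpow_sub_weight (hτ : τ ≠ 0) (r : Fin n → ℤ) :
    ∏ i, τ ^ (r i - ∑ p, wt (blockEmb l hsum i p)) = τ ^ (∑ i, r i - ∑ t, wt t) := by
  have h := prod_const_mul_zpow hτ (fun _ : Fin n => (1 : ℂ))
    (fun i => r i - ∑ p, wt (blockEmb l hsum i p))
  simp only [mul_one, one_zpow, Finset.prod_const_one] at h
  rw [h, Finset.sum_sub_distrib, sum_blockEmb]

lemma blockComponent_eq_zero {N : ℤ} (hN : ∀ k < N, A.grading k = ⊥) {r : Fin n → ℤ} {i : Fin n}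
    (hr : r i < N) (ζ : Fin n → ℂ) : blockComponent EV l hsum v y ζ r i = 0 :=
  GRVA.coe_eq_zero_of_lt hN hr _

lemma separated_contracted (hβ : ∀ i p, β (blockEmb l hsum i p) = i)
    (hτs : ∀ t, ‖τ * (y t - node n (β t))‖ < 1 / 2) {i : Fin n} (p : Fin (l i)) :
    ‖contracted β y τ (blockEmb l hsum i p) - node n i‖ < 1 / 2 := by
  have h := norm_contracted_sub_node hτs (blockEmb l hsum i p)
  rwa [hβ] at h

lemma IsCompE.hasSum_contracted {Φ : Cochain M n} {Ψ : Cochain M m}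
    (h : IsCompE EV Φ m l hsum Ψ) (hEV : IsEVFam A EV) (hv : ∀ t, v t ∈ A.grading (wt t))
    (hβ : ∀ i p, β (blockEmb l hsum i p) = i) (hy : ∀ s t, s ≠ t → y s ≠ y t) (hτ : τ ≠ 0)
    (hτs : ∀ t, ‖τ * (y t - node n (β t))‖ < 1 / 2) (φ : W →ₗ[ℂ] ℂ) (c : ℂ) :
    HasSum (fun r : Fin n → ℤ => τ ^ (∑ i, r i - ∑ t, wt t) *
      φ (Φ (blockComponent EV l hsum v y (node n) r) (node n) c))
      (φ (Ψ v (contracted β y τ) c)) := by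
  have h1 := (h v _ (GRMod.gradedFunctional_comp_proj φ c)).2 (node n) (contracted β y τ)
    (fun i j hij => (node_injective n).ne hij)
    (contracted_ne hτs hτ hy)
    (fun i j hij p p' => by
      have h2 := one_le_norm_node_sub hij
      have h3 := separated_contracted hβ hτs p
      have h4 := separated_contracted hβ hτs p'
      linarith)
  rw [GRMod.pairBar_comp_proj] at h1
  refine hasSum_of_forall_eq h1 fun r => ?_
  have h2 : (fun i => ((EV (l i) (fun p => v (blockEmb l hsum i p))
      (fun p => contracted β y τ (blockEmb l hsum i p) - node n i)) (r i) : V))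
      = fun i => τ ^ (r i - ∑ p, wt (blockEmb l hsum i p)) •
        blockComponent EV l hsum v y (node n) r i :=
    funext fun i => blockComponent_contracted hEV hv hβ hy hτ r i
  rw [h2, MultilinearMap.map_smul_univ, prod_zpow_sub_weight hτ, GRMod.pairBar_comp_proj]
  simp

lemma map_append_smul {q : ℕ} (Φ : Cochain M (q + n)) (a : Fin q → V) (c : Fin n → ℂ)
    (u : Fin n → V) :
    Φ (Fin.append a fun i => c i • u i) = (∏ i, c i) • Φ (Fin.append a u) := by
  have h : (Fin.append a fun i => c i • u i)
      = fun t => Fin.append (fun _ : Fin q => (1 : ℂ)) c t • Fin.append a u t := by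
    funext t
    induction t using Fin.addCases with
    | left t => simp
    | right t => simp
  rw [h, MultilinearMap.map_smul_univ, Fin.prod_univ_add]
  simp

lemma append_left_injective {q : ℕ} (a : Fin q → ℤ) :
    Function.Injective fun r : Fin n → ℤ => Fin.append a r := fun r r' h => by
  funext i
  simpa using congrFun h (Fin.natAdd q i)

lemma IsCompE.hasSum_append {q : ℕ} {Φ : Cochain M (q + n)} {Ψ : Cochain M (q + m)}
    {hsum' : ∑ i : Fin (q + n), (Fin.append (fun _ : Fin q => 1) l) i = q + m}
    (h : IsCompE EV Φ (q + m) (Fin.append (fun _ : Fin q => 1) l) hsum' Ψ)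
    (hEV : IsEVFam A EV) {a : Fin q → V} {wta : Fin q → ℤ} (ha : ∀ t, a t ∈ A.grading (wta t))
    (hv : ∀ t, v t ∈ A.grading (wt t))
    (hβ : ∀ i p, β (blockEmb l hsum i p) = i) (hy : ∀ s t, s ≠ t → y s ≠ y t) (hτ : τ ≠ 0)
    (hτs : ∀ t, ‖τ * (y t - node n (β t))‖ < 1 / 2) {x : Fin q → ℂ}
    (hx : ∀ s t, s ≠ t → x s ≠ x t) (hxn : ∀ t, n + 2 < ‖x t‖) (φ : W →ₗ[ℂ] ℂ) (c : ℂ) :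
    HasSum (fun r : Fin n → ℤ => τ ^ (∑ i, r i - ∑ t, wt t) *
      φ (Φ (Fin.append a (blockComponent EV l hsum v y (node n) r)) (Fin.append x (node n)) c))
      (φ (Ψ (Fin.append a v) (Fin.append x (contracted β y τ)) c)) := by
  have hxζ (i : Fin q) (j : Fin n) : 2 < ‖x i - node n j‖ := by
    have h1 := hxn i
    have h2 := norm_node_le j
    have h3 := norm_sub_norm_le (x i) (node n j)
    linarith
  have hdevL (i : Fin q) (p : Fin (Fin.append (fun _ : Fin q => 1) l (Fin.castAdd n i))) :
      Fin.append x (contracted β y τ) (blockEmb _ hsum' (Fin.castAdd n i) p)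
        - Fin.append x (node n) (Fin.castAdd n i) = 0 := by
    rw [blockEmb_append_castAdd, Fin.append_left, Fin.append_left, sub_self]
  have hdevR (j : Fin n) (p : Fin (Fin.append (fun _ : Fin q => 1) l (Fin.natAdd q j))) :
      ‖Fin.append x (contracted β y τ) (blockEmb _ hsum' (Fin.natAdd q j) p)
        - Fin.append x (node n) (Fin.natAdd q j)‖ < 1 / 2 := by
    rw [blockEmb_append_natAdd (hsum := hsum), Fin.append_right x (contracted β y τ),
      Fin.append_right x (node n)]
    exact separated_contracted hβ hτs _
  have h1 := (h (Fin.append a v) _ (GRMod.gradedFunctional_comp_proj φ c)).2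
    (Fin.append x (node n)) (Fin.append x (contracted β y τ))
    (append_ne hx (fun _ _ h => (node_injective n).ne h) fun s t => by
      have h1 := hxn s
      have h2 := norm_node_le t
      linarith)
    (append_ne hx (contracted_ne hτs hτ hy) fun s t => by
      have h1 := hxn s
      have h2 := norm_contracted_lt hτs t
      linarith)
    (fun i j hij p p' => by
      induction i using Fin.addCases with
      | left i =>
        rw [hdevL, norm_zero, zero_add]
        induction j using Fin.addCases with
        | left j =>
          rw [hdevL, norm_zero, Fin.append_left, Fin.append_left, norm_pos_iff, sub_ne_zero]
          exact hx i j fun h => hij (by rw [h])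
        | right j =>
          have h2 := hdevR j p'
          have h3 := hxζ i j
          rw [Fin.append_left x (node n), Fin.append_right x (node n)]
          rw [Fin.append_right x (node n)] at h2
          linarith
      | right i =>
        have h2 := hdevR i p
        rw [Fin.append_right x (node n)] at h2 ⊢
        induction j using Fin.addCases with
        | left j =>
          have h3 := hxζ j i
          rw [hdevL, norm_zero, add_zero, Fin.append_left x (node n), norm_sub_rev (node n i)]
          linarith
        | right j =>
          have h4 := hdevR j p'
          rw [Fin.append_right x (node n)] at h4 ⊢
          have h3 := one_le_norm_node_sub (n := n) (i := i) (j := j)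
            fun h => hij (by rw [h])
          linarith)
  rw [GRMod.pairBar_comp_proj] at h1
  have hval (i : Fin q) (k : ℤ) := hEV.apply_one_zero
    (Fin.append_left (fun _ : Fin q => 1) l i)
    (v := fun p => Fin.append a v (blockEmb _ hsum' (Fin.castAdd n i) p)) (u := a i)
    (fun p => by rw [blockEmb_append_castAdd, Fin.append_left]) (ha i) (hdevL i) k
  refine hasSum_of_forall_eq (((append_left_injective wta).hasSum_iff fun r hr => ?_).2 h1)
    fun r => ?_
  · have hex : ∃ i, r (Fin.castAdd n i) ≠ wta i := by
      by_contra hne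
      push Not at hne
      refine hr ⟨fun j => r (Fin.natAdd q j), ?_⟩
      funext t
      induction t using Fin.addCases with
      | left t => simp [hne t]
      | right t => simp
    obtain ⟨i, hi⟩ := hex
    rw [GRMod.pairBar_comp_proj, MultilinearMap.map_coord_zero _ (Fin.castAdd n i)]
    · simp
    · rw [hval, if_neg hi]
  · have h2 : (fun i => ((EV (Fin.append (fun _ : Fin q => 1) l i)
        (fun p => Fin.append a v (blockEmb _ hsum' i p))
        (fun p => Fin.append x (contracted β y τ) (blockEmb _ hsum' i p)
          - Fin.append x (node n) i)) (Fin.append wta r i) : V))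
        = Fin.append a fun i => τ ^ (r i - ∑ p, wt (blockEmb l hsum i p)) •
          blockComponent EV l hsum v y (node n) r i := by
      funext t
      induction t using Fin.addCases with
      | left t => rw [hval, Fin.append_left, Fin.append_left, if_pos rfl]
      | right t =>
        rw [Fin.append_right a, ← blockComponent_contracted hEV hv hβ hy hτ, blockComponent,
          Fin.append_right wta]
        rw [EV_congr EV (Fin.append_right (fun _ : Fin q => 1) l t)
          (v' := fun p => v (blockEmb l hsum t p))
          (z' := fun p => contracted β y τ (blockEmb l hsum t p) - node n t)]
        · intro p
          rw [blockEmb_append_natAdd (hsum := hsum), Fin.append_right]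
        · intro p
          rw [blockEmb_append_natAdd (hsum := hsum), Fin.append_right x (contracted β y τ),
      Fin.append_right x (node n)]
    rw [Function.comp_apply, h2, map_append_smul, prod_zpow_sub_weight hτ,
      GRMod.pairBar_comp_proj]
    simp

end Composition

lemma MultilinearMap.eq_of_eq_on_homogeneous {A : GRVA V} {X : Type*} [AddCommGroup X] [Module ℂ X]
    {T : ℕ} {f g : MultilinearMap ℂ (fun _ : Fin T => V) X}
    (h : ∀ (v : Fin T → V) (wt : Fin T → ℤ), (∀ t, v t ∈ A.grading (wt t)) → f v = g v)
    (v : Fin T → V) : f v = g v := by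
  let := A.decomp
  have hv : v = fun t => ∑ k ∈ (DirectSum.decompose A.grading (v t)).support,
      (DirectSum.decompose A.grading (v t) k : V) :=
    funext fun t => (DirectSum.sum_support_decompose A.grading (v t)).symm
  rw [hv, MultilinearMap.map_sum_finset, MultilinearMap.map_sum_finset]
  exact Finset.sum_congr rfl fun k _ => h _ k fun t => (DirectSum.decompose A.grading (v t) (k t)).2

lemma contracted_one {n m : ℕ} (β : Fin m → Fin n) (y : Fin m → ℂ) : contracted β y 1 = y := by
  funext t
  simp [contracted]

lemma isLaurent_append_contracted {n m q : ℕ} (β : Fin m → Fin n) (x : Fin q → ℂ)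
    (y : Fin m → ℂ) (t : Fin (q + m)) :
    IsLaurent fun s τ => Fin.append (fun i => s⁻¹ * x i) (contracted β y τ) t := by
  induction t using Fin.addCases with
  | left t =>
    refine (IsLaurent.monomial (x t) (-1) 0).congr fun s τ => ?_
    rw [Fin.append_left, zpow_neg_one, zpow_zero]
    ring
  | right t =>
    refine ((IsLaurent.monomial (node n (β t)) 0 0).add
      (IsLaurent.monomial (y t - node n (β t)) 0 1)).congr fun s τ => ?_
    rw [Fin.append_right, contracted, zpow_zero, zpow_zero, zpow_one]
    ring

lemma RatDiag.apply_component {A : GRVA V} {M : GRMod V W A} {T : ℕ} {φ : W →ₗ[ℂ] ℂ} {d : ℂ}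
    {f : (Fin T → ℂ) → WbarT M} (h : RatDiag T fun z => pairBar (φ ∘ₗ M.proj d) (f z)) :
    RatDiag T fun z => φ (f z d) := by
  simpa only [GRMod.pairBar_comp_proj] using h

lemma dual_compW_compE_append {A : GRVA V} {M : GRMod V W A}
    {EV : ∀ l : ℕ, (Fin l → V) → (Fin l → ℂ) → VbarT A} (hEV : IsEVFam A EV)
    {EW : ∀ m : ℕ, (Fin m → V) → W → (Fin m → ℂ) → WbarT M} (hEW : IsEWFam M EW)
    {n m q : ℕ} {Φ : Cochain M n} {l : Fin n → ℕ} {hsum : ∑ i, l i = m}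
    {Ψ₁ : Cochain M m} (h₁ : IsCompE EV Φ m l hsum Ψ₁)
    {Ψ₂ : Cochain M (q + m)} (h₂ : IsCompW EW Ψ₁ q Ψ₂)
    {Ψ₃ : Cochain M (q + n)} (h₃ : IsCompW EW Φ q Ψ₃)
    {hsum' : ∑ i : Fin (q + n), (Fin.append (fun _ : Fin q => 1) l) i = q + m}
    {Ψ₄ : Cochain M (q + m)}
    (h₄ : IsCompE EV Ψ₃ (q + m) (Fin.append (fun _ : Fin q => 1) l) hsum' Ψ₄)
    {a : Fin q → V} {wta : Fin q → ℤ} (ha : ∀ t, a t ∈ A.grading (wta t))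
    {v : Fin m → V} {wt : Fin m → ℤ} (hv : ∀ t, v t ∈ A.grading (wt t))
    {x : Fin q → ℂ} (hx : RadiallyOrdered x) {y : Fin m → ℂ}
    (hxy : ∀ s t, s ≠ t → Fin.append x y s ≠ Fin.append x y t) (φ : W →ₗ[ℂ] ℂ) (d : ℂ) :
    φ (Ψ₂ (Fin.append a v) (Fin.append x y) d) = φ (Ψ₄ (Fin.append a v) (Fin.append x y) d) := by
  have hy : ∀ s t, s ≠ t → y s ≠ y t := fun s t hst => by
    have h := hxy (Fin.natAdd q s) (Fin.natAdd q t) (by simpa using hst)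
    rwa [Fin.append_right, Fin.append_right] at h
  have hφ := GRMod.gradedFunctional_comp_proj (M := M) φ d
  obtain ⟨β, hβ⟩ := exists_blockIndex hsum
  obtain ⟨ε₁, hε₁, hsmall⟩ := exists_small fun t => y t - node n (β t)
  obtain ⟨ε₂, hε₂, hlarge⟩ := exists_large hx.2 (R := n + 2) (by positivity)
  obtain ⟨N, hN⟩ := A.lower_bounded
  obtain ⟨Nκ, hNκ⟩ := M.exists_coe_eq_zero (d - (∑ t, wta t : ℤ))
  obtain ⟨E, hE⟩ := hEW.exists_linearMap a hx hφ
  set w : ℤ := ∑ t, wt t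
  set u := fun r => blockComponent EV l hsum v y (node n) r
  set c : ℤ → (Fin n → ℤ) → ℂ := fun κ r =>
    E (Φ (u r) (node n) (d - (∑ t, wta t : ℤ) + κ)) with hc
  set b : ℤ → ℤ → ℂ := fun κ ρ => ∑ r ∈ degreeFiber n N w ρ, c κ r with hb
  have hb0 : ∃ N', ∀ κ ρ, κ < N' ∨ ρ < N' → b κ ρ = 0 := by
    refine ⟨min Nκ (n * N - w), fun κ ρ h => ?_⟩
    rcases h with h | h
    · refine Finset.sum_eq_zero fun r _ => ?_
      rw [hc]
      simp only
      rw [hNκ κ (h.trans_le (min_le_left _ _)), map_zero]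
    · rw [hb]
      simp only
      rw [degreeFiber_eq_empty (h.trans_le (min_le_right _ _)), Finset.sum_empty]
  have hu0 {r : Fin n → ℤ} (hr : ∃ i, r i < N) : ∃ i, u r i = 0 :=
    hr.imp fun i hi => blockComponent_eq_zero hN hi _
  have hxs {s : ℂ} (hs : s ≠ 0) := hx.mul_const (inv_ne_zero hs)
  have hdist {s τ : ℂ} (hs : s ≠ 0) (hsε : ‖s‖ < ε₂) (hτ : τ ≠ 0) (hτε : ‖τ‖ < ε₁) :
      ∀ i j, i ≠ j → Fin.append (fun i => s⁻¹ * x i) (contracted β y τ) i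
        ≠ Fin.append (fun i => s⁻¹ * x i) (contracted β y τ) j :=
    append_ne (hxs hs).ne (contracted_ne (hsmall τ hτε) hτ hy) fun i j => by
      have h1 := hlarge s hs hsε i
      have h2 := norm_contracted_lt (hsmall τ hτε) j
      linarith
  have hF : IterSum (min ε₁ ε₂) b fun s τ =>
      φ (Ψ₂ (Fin.append a v) (Fin.append (fun i => s⁻¹ * x i) (contracted β y τ)) d) := by
    refine ⟨hb0, fun κ τ => E (Ψ₁ v (contracted β y τ) (d - (∑ t, wta t : ℤ) + κ)),
      fun τ hτ hτε κ => ?_, fun s τ hs hsε hτ hτε => ?_⟩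
    · refine hasSum_group_degree (fun r hr => ?_) (h₁.hasSum_contracted hEV hv hβ hy hτ
        (hsmall τ (hτε.trans_le (min_le_left _ _))) E _)
      obtain ⟨i, hi⟩ := hu0 hr
      rw [hc]
      simp only
      rw [MultilinearMap.map_coord_zero _ i hi]
      simp
    · have hsε' := hsε.trans_le (min_le_right ε₁ ε₂)
      have hτε' := hτε.trans_le (min_le_left ε₁ ε₂)
      have h := (h₂ (Fin.append a v) _ hφ).2 _ (hdist hs hsε' hτ hτε')
        (fun i j => by
          have h1 := hlarge s hs hsε' i
          have h2 := norm_contracted_lt (hsmall τ hτε') j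
          rw [Fin.append_left, Fin.append_right]
          linarith)
        (fun j => by
          rw [Fin.append_right]
          exact contracted_ne_zero (hsmall τ hτε') j)
      simp only [Fin.append_left, Fin.append_right] at h
      rw [GRMod.pairBar_comp_proj] at h
      refine hasSum_of_forall_eq (hEW.hasSum_int ha hx φ hs h) fun κ => ?_
      simp only [hE]
  have hG : IterSum (min ε₁ ε₂) (fun ρ κ => b κ ρ) fun τ s =>
      φ (Ψ₄ (Fin.append a v) (Fin.append (fun i => s⁻¹ * x i) (contracted β y τ)) d) := by
    refine ⟨?_, fun ρ s => ∑ r ∈ degreeFiber n N w ρ,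
      φ (Ψ₃ (Fin.append a (u r)) (Fin.append (fun i => s⁻¹ * x i) (node n)) d),
      fun s hs hsε ρ => ?_, fun τ s hτ hτε hs hsε => ?_⟩
    · obtain ⟨N', hN'⟩ := hb0
      exact ⟨N', fun ρ κ h => hN' κ ρ h.symm⟩
    · have hsε' := hsε.trans_le (min_le_right ε₁ ε₂)
      have hterm (r : Fin n → ℤ) := by
        have h := (h₃ (Fin.append a (u r)) _ hφ).2 (Fin.append (fun i => s⁻¹ * x i) (node n))
          (append_ne (hxs hs).ne (fun _ _ h => (node_injective n).ne h) fun i j => by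
            have h1 := hlarge s hs hsε' i
            have h2 := norm_node_le j
            linarith)
          (fun i j => by
            have h1 := hlarge s hs hsε' i
            have h2 := norm_node_le j
            rw [Fin.append_left, Fin.append_right]
            linarith)
          (fun j => by
            rw [Fin.append_right, ← norm_pos_iff]
            exact one_pos.trans_le (one_le_norm_node j))
        simp only [Fin.append_left, Fin.append_right] at h
        rw [GRMod.pairBar_comp_proj] at h
        exact hEW.hasSum_int ha hx φ hs h
      refine hasSum_of_forall_eq (hasSum_sum fun r (_ : r ∈ degreeFiber n N w ρ) => hterm r)
        fun κ => ?_
      rw [hb, Finset.mul_sum]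
      simp only [hc, hE]
    · have hsε' := hsε.trans_le (min_le_right ε₁ ε₂)
      have hτε' := hτε.trans_le (min_le_left ε₁ ε₂)
      refine hasSum_group_degree (fun r hr => ?_) (h₄.hasSum_append hEV ha hv hβ hy hτ
        (hsmall τ hτε') (hxs hs).ne (hlarge s hs hsε') φ d)
      obtain ⟨i, hi⟩ := hu0 hr
      rw [MultilinearMap.map_coord_zero _ (Fin.natAdd q i)
        (by rw [Fin.append_right]; exact hi)]
      simp
  have h1 : Fin.append (fun i => (1 : ℂ)⁻¹ * x i) (contracted β y 1) = Fin.append x y := by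
    simp [contracted_one]
  have key := RatDiag.eq_of_iterSum (RatDiag.apply_component (h₂ (Fin.append a v) _ hφ).1)
    (RatDiag.apply_component (h₄ (Fin.append a v) _ hφ).1)
    (z := fun s τ => Fin.append (fun i => s⁻¹ * x i) (contracted β y τ))
    (isLaurent_append_contracted β x y) (lt_min hε₁ hε₂)
    (fun s τ hs hsε hτ hτε => hdist hs (hsε.trans_le (min_le_right _ _)) hτ
      (hτε.trans_le (min_le_left _ _))) hF hG one_ne_zero one_ne_zero (by rw [h1]; exact hxy)
  simp only [h1] at key
  exact key

/-- Proposition 3.8, conclusion 3: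
`E^{(q)}_W ∘_{q+1} (Φ ∘ (E^{(l₁)}_{V;𝟏} ⊗ ⋯ ⊗ E^{(lₙ)}_{V;𝟏}))
 = (E^{(q)}_W ∘_{q+1} Φ) ∘ (E^{(1)}_{V;𝟏} ⊗ ⋯ ⊗ E^{(1)}_{V;𝟏} ⊗ E^{(l₁)}_{V;𝟏} ⊗ ⋯ ⊗ E^{(lₙ)}_{V;𝟏})`
(the first `q` arguments of `E^{(q)}_W ∘_{q+1} Φ` receiving the trivial blocks
`E^{(1)}_{V;𝟏}`), as `W̄`-valued rational functions on the configuration space. -/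
theorem compW_compE_associativity
    (A : GRVA V) (M : GRMod V W A)
    (EV : ∀ l : ℕ, (Fin l → V) → (Fin l → ℂ) → VbarT A) (hEV : IsEVFam A EV)
    (EW : ∀ m : ℕ, (Fin m → V) → W → (Fin m → ℂ) → WbarT M) (hEW : IsEWFam M EW)
    (n m p q : ℕ) (hp : 1 ≤ p) (hq : 1 ≤ q) (hpq : p + q ≤ m)
    (Φ : Cochain M n) (hrat : TakesRatValues Φ) (hcomp : Composable EV EW m Φ)
    (l : Fin n → ℕ) (hl : ∀ i, 0 < l i) (hsum : ∑ i, l i = p + n)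
    (Ψ₁ : Cochain M (p + n)) (h₁ : IsCompE EV Φ (p + n) l hsum Ψ₁)
    (Ψ₂ : Cochain M (q + (p + n))) (h₂ : IsCompW EW Ψ₁ q Ψ₂)
    (Ψ₃ : Cochain M (q + n)) (h₃ : IsCompW EW Φ q Ψ₃)
    (hl' : ∑ i : Fin (q + n), (Fin.append (fun _ : Fin q => 1) l) i = q + (p + n))
    (Ψ₄ : Cochain M (q + (p + n)))
    (h₄ : IsCompE EV Ψ₃ (q + (p + n)) (Fin.append (fun _ : Fin q => 1) l) hl' Ψ₄)
    (v : Fin (q + (p + n)) → V) (z : Fin (q + (p + n)) → ℂ)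
    (hdist : ∀ s t, s ≠ t → z s ≠ z t) :
    Ψ₂ v z = Ψ₄ v z := by
  suffices h : ((LinearMap.proj z).compMultilinearMap Ψ₂) v
      = ((LinearMap.proj z).compMultilinearMap Ψ₄) v from h
  refine MultilinearMap.eq_of_eq_on_homogeneous (A := A) (fun v wt hv => ?_) v
  change Ψ₂ v z = Ψ₄ v z
  refine funext fun d => Subtype.ext (eq_of_forall_dual_apply_eq fun φ => ?_)
  have hφ := GRMod.gradedFunctional_comp_proj (M := M) φ d
  refine RatDiag.eq_of_eq_on_radiallyOrdered (f := fun z => φ (Ψ₂ v z d))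
    (g := fun z => φ (Ψ₄ v z d)) (RatDiag.apply_component (h₂ v _ hφ).1)
    (RatDiag.apply_component (h₄ v _ hφ).1) (fun x hx => ?_) hdist
  have hv' := Fin.append_castAdd_natAdd (f := v)
  have hx' := Fin.append_castAdd_natAdd (f := x)
  have hxq : RadiallyOrdered fun i => x (Fin.castAdd (p + n) i) :=
    ⟨fun i j hij => hx.1 _ _ hij, fun i => hx.2 _⟩
  have key := dual_compW_compE_append hEV hEW h₁ h₂ h₃ h₄
    (fun i => hv (Fin.castAdd (p + n) i)) (fun i => hv (Fin.natAdd q i)) hxq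
    (y := fun i => x (Fin.natAdd q i)) (by rw [hx']; exact hx.ne) φ d
  rwa [hv', hx'] at key
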